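/- (Bétermin's Theorem) For every t > 0 and every unimodular lattice L = A(ℤ²) with A ∈ SL(2,ℝ), one has Σ_{p ∈ L \ {0}} exp(−t‖p‖) ≥ Σ_{p ∈ L_Δ \ {0}} exp(−t‖p‖), with equality if and only if L = R(L_Δ) for some rotation R ∈ SO(2). -/

import Mathlib

noncomputable section

/-- The linear action of a 2×2 real matrix on the Euclidean plane. -/
def act (A : Matrix (Fin 2) (Fin 2) ℝ) (v : EuclideanSpace ℝ (Fin 2)) :
    EuclideanSpace ℝ (Fin 2) :=
  (WithLp.equiv 2 (Fin 2 → ℝ)).symm (A.mulVec (WithLp.equiv 2 (Fin 2 → ℝ) v))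

/-- The standard integer lattice `ℤ² ⊂ ℝ²`. -/
def intLat : Set (EuclideanSpace ℝ (Fin 2)) :=
  {v | ∃ a b : ℤ, v 0 = (a : ℝ) ∧ v 1 = (b : ℝ)}

/-- The unimodular equilateral triangular lattice, spanned by `c•(1,0)` and
`c•(1/2, √3/2)` with `c = (2/√3)^(1/2)`, so that its covolume is `1`. -/
def triLat : Set (EuclideanSpace ℝ (Fin 2)) :=
  {v | ∃ a b : ℤ,
    v 0 = (a : ℝ) * Real.sqrt (2 / Real.sqrt 3)
        + (b : ℝ) * Real.sqrt (2 / Real.sqrt 3) / 2 ∧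
    v 1 = (b : ℝ) * Real.sqrt (2 / Real.sqrt 3) * Real.sqrt 3 / 2}

/-- `f_t(L) = ∑_{p ∈ L \ {0}} exp (-t ‖p‖)`. -/
def fLat (t : ℝ) (L : Set (EuclideanSpace ℝ (Fin 2))) : ℝ :=
  ∑' p : (L \ {0} : Set (EuclideanSpace ℝ (Fin 2))),
    Real.exp (-t * ‖(p : EuclideanSpace ℝ (Fin 2))‖)

/-- `R` belongs to the rotation group `SO(2)`. -/
def IsRotation (R : Matrix (Fin 2) (Fin 2) ℝ) : Prop :=
  R.det = 1 ∧ R * R.transpose = 1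

namespace BM
open Real Set Filter Topology MeasureTheory

/-- The primitive of the Gaussian. -/
noncomputable def G (x : ℝ) : ℝ := ∫ u in (0:ℝ)..x, exp (-u ^ 2)

lemma G_deriv (x : ℝ) : HasDerivAt G (exp (-x ^ 2)) x := by
  have hc : Continuous fun u : ℝ => exp (-u ^ 2) := by fun_prop
  exact intervalIntegral.integral_hasDerivAt_right (hc.intervalIntegrable _ _)
    (hc.stronglyMeasurableAtFilter _ _) hc.continuousAt

lemma G_neg (x : ℝ) : G (-x) = - G x := by
  unfold G
  have := intervalIntegral.integral_comp_neg (a := 0) (b := x) (fun u : ℝ => exp (-u ^ 2))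
  simp only [neg_sq, neg_zero] at this
  rw [intervalIntegral.integral_symm, ← this]

lemma G_top : Tendsto G atTop (𝓝 (√π / 2)) := by
  have h := integral_gaussian_Ioi 1
  have hi : IntegrableOn (fun u : ℝ => exp (-u ^ 2)) (Ioi 0) := by
    have := (integrable_exp_neg_mul_sq (b := 1) one_pos).integrableOn (s := Ioi 0)
    simpa using this
  have := intervalIntegral_tendsto_integral_Ioi 0 hi tendsto_id
  simp only [div_one, neg_mul, one_mul] at h
  rw [h] at this
  exact this

lemma G_bot : Tendsto G atBot (𝓝 (-(√π / 2))) := by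
  have h := (G_top.comp tendsto_neg_atBot_atTop).neg
  refine h.congr fun x => ?_
  simp [G_neg]

/-- The subordination integrand. -/
noncomputable def sub (t r x : ℝ) : ℝ := exp (-(t ^ 2 * x ^ 2 / 4)) * exp (-(r ^ 2 / x ^ 2))

lemma subord_pos {t r : ℝ} (ht : 0 < t) (hr : 0 < r) :
    IntegrableOn (sub t r) (Ioi 0) ∧ ∫ x in Ioi 0, sub t r x = √π / t * exp (-t * r) := by
  set F0 : ℝ → ℝ := fun x => (1 / t) * (exp (t * r) * G (t / 2 * x + r / x)
    + exp (-t * r) * G (t / 2 * x - r / x)) with hF0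
  set L0 : ℝ := (1 / t) * (exp (t * r) * (√π / 2) + exp (-t * r) * (-(√π / 2))) with hL0
  set L1 : ℝ := (1 / t) * (exp (t * r) * (√π / 2) + exp (-t * r) * (√π / 2)) with hL1
  have hrx : Tendsto (fun x : ℝ => r / x) (𝓝[>] 0) atTop := by
    simpa [div_eq_mul_inv] using tendsto_inv_nhdsGT_zero.const_mul_atTop hr
  have htx0 : Tendsto (fun x : ℝ => t / 2 * x) (𝓝[>] 0) (𝓝 0) := by
    have : Tendsto (fun x : ℝ => t / 2 * x) (𝓝 0) (𝓝 (t / 2 * 0)) := by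
      apply Continuous.tendsto; fun_prop
    rw [mul_zero] at this
    exact this.mono_left nhdsWithin_le_nhds
  have hrx1 : Tendsto (fun x : ℝ => r / x) atTop (𝓝 0) := tendsto_const_nhds.div_atTop tendsto_id
  have htx1 : Tendsto (fun x : ℝ => t / 2 * x) atTop atTop :=
    tendsto_id.const_mul_atTop (by positivity)
  have l0 : Tendsto F0 (𝓝[>] 0) (𝓝 L0) := by
    refine ((Tendsto.const_mul _ (G_top.comp ?_)).add
      (Tendsto.const_mul _ (G_bot.comp ?_))).const_mul _
    · exact htx0.add_atTop hrx
    · have : Tendsto (fun x : ℝ => t / 2 * x + (-(r / x))) (𝓝[>] 0) atBot :=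
        htx0.add_atBot (tendsto_neg_atTop_atBot.comp hrx)
      simpa [sub_eq_add_neg] using this
  have l1 : Tendsto F0 atTop (𝓝 L1) := by
    refine ((Tendsto.const_mul _ (G_top.comp ?_)).add
      (Tendsto.const_mul _ (G_top.comp ?_))).const_mul _
    · exact htx1.atTop_add hrx1
    · have : Tendsto (fun x : ℝ => t / 2 * x + (-(r / x))) atTop atTop :=
        htx1.atTop_add hrx1.neg
      simpa [sub_eq_add_neg] using this
  have hd : ∀ x ∈ Ioi (0:ℝ), HasDerivAt F0 (sub t r x) x := by
    intro x hx
    have hx0 : x ≠ 0 := ne_of_gt hx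
    have h1 : HasDerivAt (fun x : ℝ => t / 2 * x) (t / 2) x := by
      simpa using (hasDerivAt_id x).const_mul (t / 2)
    have h2 : HasDerivAt (fun x : ℝ => r / x) (-r / x ^ 2) x := by
      have := (hasDerivAt_inv hx0).const_mul r
      refine this.congr_deriv ?_
      field_simp
    have h3 := (G_deriv (t / 2 * x + r / x)).comp x (h1.add h2)
    have h4 := (G_deriv (t / 2 * x - r / x)).comp x (h1.sub h2)
    have h5 := ((h3.const_mul (exp (t * r))).add (h4.const_mul (exp (-t * r)))).const_mul (1 / t)
    refine h5.congr_deriv ?_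
    have e1 : exp (t * r) * exp (-(t / 2 * x + r / x) ^ 2) = sub t r x := by
      unfold sub; rw [← exp_add, ← exp_add]; congr 1; field_simp; ring
    have e2 : exp (-t * r) * exp (-(t / 2 * x - r / x) ^ 2) = sub t r x := by
      unfold sub; rw [← exp_add, ← exp_add]; congr 1; field_simp; ring
    rw [← mul_assoc, ← mul_assoc, e1, e2]
    field_simp
    ring
  have hd' : ∀ x ∈ Ioi (0:ℝ), HasDerivAt (Function.update F0 0 L0) (sub t r x) x := by
    intro x hx
    refine (hd x hx).congr_of_eventuallyEq ?_
    filter_upwards [isOpen_Ioi.mem_nhds hx] with z hz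
    rw [Function.update_of_ne (ne_of_gt hz)]
  have hc : ContinuousWithinAt (Function.update F0 0 L0) (Ici 0) 0 := by
    rw [continuousWithinAt_update_same]
    simpa using l0
  have l1' : Tendsto (Function.update F0 0 L0) atTop (𝓝 L1) := by
    refine l1.congr' ?_
    filter_upwards [eventually_gt_atTop 0] with z hz
    rw [Function.update_of_ne (ne_of_gt hz)]
  have hpos : ∀ x ∈ Ioi (0:ℝ), 0 ≤ sub t r x := fun x _ => by unfold sub; positivity
  refine ⟨integrableOn_Ioi_deriv_of_nonneg hc hd' hpos l1', ?_⟩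
  rw [integral_Ioi_of_hasDerivAt_of_nonneg hc hd' hpos l1', Function.update_self]
  rw [hL0, hL1]; ring

lemma subord {t r : ℝ} (ht : 0 < t) (hr : 0 ≤ r) :
    IntegrableOn (sub t r) (Ioi 0) ∧ ∫ x in Ioi 0, sub t r x = √π / t * exp (-t * r) := by
  rcases hr.eq_or_lt with rfl | h
  · have e : sub t 0 = fun x : ℝ => exp (-(t ^ 2 / 4) * x ^ 2) := by
      funext x; unfold sub; simp; ring
    rw [e]
    refine ⟨(integrable_exp_neg_mul_sq (by positivity)).integrableOn, ?_⟩
    rw [integral_gaussian_Ioi]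
    have : π / (t ^ 2 / 4) = π * (2 / t) ^ 2 := by field_simp; norm_num
    rw [this, Real.sqrt_mul pi_pos.le, Real.sqrt_sq (by positivity)]
    simp; field_simp
  · exact subord_pos ht h

end BM

namespace BM
open Real Set Filter Topology MeasureTheory

/-- The reduced unimodular quadratic form. -/
noncomputable def N (x y : ℝ) (v : ℤ × ℤ) : ℝ := (v.1:ℝ) ^ 2 * y + ((v.2:ℝ) + v.1 * x) ^ 2 / y

lemma N_nonneg {x y : ℝ} (hy : 0 < y) (v : ℤ × ℤ) : 0 ≤ N x y v := by unfold N; positivity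

noncomputable def theta (α x y : ℝ) : ℝ := ∑' v : ℤ × ℤ, exp (-(π * α * N x y v))

lemma hasSum_natAbs {g : ℕ → ℝ} {a : ℝ} (h : HasSum g a) :
    HasSum (fun n : ℤ => g n.natAbs) (a + (a - g 0)) := by
  refine HasSum.of_nat_of_neg_add_one ?_ ?_
  · simpa using h
  · have h1 : HasSum (fun n : ℕ => g (n + 1)) (a - g 0) := by
      simpa using (hasSum_nat_add_iff' (f := g) 1).2 h
    refine h1.congr_fun fun n => ?_
    congr 1

/-- The basic majorant. -/
noncomputable def maj (κ : ℝ) (v : ℤ × ℤ) : ℝ := exp (-(κ * (|(v.1:ℝ)| + |(v.2:ℝ)|)))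

lemma summable_exp_abs {κ : ℝ} (hκ : 0 < κ) : Summable fun n : ℤ => exp (-(κ * |(n:ℝ)|)) := by
  have h : Summable fun n : ℕ => (exp (-κ)) ^ n :=
    summable_geometric_of_lt_one (exp_pos _).le (by simpa using hκ)
  refine (hasSum_natAbs h.hasSum).summable.congr fun n => ?_
  rw [← exp_nat_mul, Nat.cast_natAbs, Int.cast_abs]
  congr 1; ring

lemma summable_maj {κ : ℝ} (hκ : 0 < κ) : Summable (maj κ) := by
  refine ((summable_exp_abs hκ).mul_of_nonneg (summable_exp_abs hκ)
    (fun _ => (exp_pos _).le) (fun _ => (exp_pos _).le)).congr fun v => ?_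
  rw [maj, ← exp_add]; congr 1; ring

lemma N_lower {x y : ℝ} (hy : 0 < y) :
    ∃ l : ℝ, 0 < l ∧ ∀ v : ℤ × ℤ, l * (|(v.1:ℝ)| + |(v.2:ℝ)|) ^ 2 ≤ N x y v := by
  refine ⟨((2 + 4 * x ^ 2) / y + 4 * y)⁻¹, by positivity, fun v => ?_⟩
  rw [inv_mul_le_iff₀ (by positivity)]
  unfold N
  obtain ⟨m', n'⟩ := v
  dsimp only
  generalize (m' : ℝ) = m
  generalize (n' : ℝ) = n
  have h1 : (|m| + |n|) ^ 2 ≤ 2 * m ^ 2 + 2 * n ^ 2 := by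
    nlinarith [sq_nonneg (|m| - |n|), sq_abs m, sq_abs n]
  have h2 : n ^ 2 ≤ 2 * (n + m * x) ^ 2 + 2 * (m * x) ^ 2 := by
    nlinarith [sq_nonneg (n + 2 * (m * x))]
  have e : ((2 + 4 * x ^ 2) / y + 4 * y) * (m ^ 2 * y + (n + m * x) ^ 2 / y)
      = (2 + 4 * x ^ 2) * m ^ 2 + 4 * (n + m * x) ^ 2
        + ((2 + 4 * x ^ 2) / y * ((n + m * x) ^ 2 / y) + 4 * y * (m ^ 2 * y)) := by
    field_simp; ring
  rw [e]
  have h3 : 0 ≤ ((2 + 4 * x ^ 2) / y * ((n + m * x) ^ 2 / y) + 4 * y * (m ^ 2 * y)) := by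
    positivity
  nlinarith

lemma abs_le_sq (v : ℤ × ℤ) : |(v.1:ℝ)| + |(v.2:ℝ)| ≤ (|(v.1:ℝ)| + |(v.2:ℝ)|) ^ 2 := by
  have : |v.1| + |v.2| ≤ (|v.1| + |v.2|) ^ 2 := by
    exact Int.le_self_sq _
  exact_mod_cast this

lemma summable_sqrtN {x y t : ℝ} (hy : 0 < y) (ht : 0 < t) :
    Summable fun v => exp (-t * √(N x y v)) := by
  obtain ⟨l, hl, h⟩ := N_lower (x := x) hy
  refine Summable.of_nonneg_of_le (fun _ => (exp_pos _).le) (fun v => ?_)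
    (summable_maj (κ := t * √l) (by positivity))
  rw [maj, exp_le_exp]
  have : √l * (|(v.1:ℝ)| + |(v.2:ℝ)|) ≤ √(N x y v) := by
    apply Real.le_sqrt_of_sq_le
    rw [mul_pow, Real.sq_sqrt hl.le]; exact h v
  nlinarith

lemma summable_theta {x y α : ℝ} (hy : 0 < y) (hα : 0 < α) :
    Summable fun v => exp (-(π * α * N x y v)) := by
  obtain ⟨l, hl, h⟩ := N_lower (x := x) hy
  refine Summable.of_nonneg_of_le (fun _ => (exp_pos _).le) (fun v => ?_)
    (summable_maj (κ := π * α * l) (by positivity))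
  rw [maj, exp_le_exp]
  have h1 : l * (|(v.1:ℝ)| + |(v.2:ℝ)|) ≤ N x y v :=
    (mul_le_mul_of_nonneg_left (abs_le_sq v) hl.le).trans (h v)
  have : 0 < π * α := by positivity
  nlinarith

lemma summable_Ntheta {x y α : ℝ} (hy : 0 < y) (hα : 0 < α) :
    Summable fun v => N x y v * exp (-(π * α * N x y v)) := by
  have hα2 : 0 < α / 2 := by positivity
  refine Summable.of_nonneg_of_le (fun v => mul_nonneg (N_nonneg hy v) (exp_pos _).le)
    (fun v => ?_) ((summable_theta (x := x) hy hα2).mul_left (2 / (π * α)))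
  have h := add_one_le_exp (π * α * N x y v / 2)
  have e : exp (-(π * α * N x y v)) =
      exp (-(π * (α / 2) * N x y v)) * exp (-(π * α * N x y v / 2)) := by
    rw [← exp_add]; congr 1; ring
  rw [e, exp_neg (π * α * N x y v / 2)]
  have h2 : N x y v ≤ 2 / (π * α) * exp (π * α * N x y v / 2) := by
    rw [div_mul_eq_mul_div, le_div_iff₀ (by positivity)]; nlinarith
  have h3 := exp_pos (π * α * N x y v / 2)
  have h4 := exp_pos (-(π * (α / 2) * N x y v))
  rw [mul_comm (exp _) (exp _)⁻¹, ← mul_assoc, mul_comm _ (exp (-_))]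
  rw [mul_comm (2 / (π * α))]
  gcongr
  rwa [← div_eq_mul_inv, div_le_iff₀ h3]

lemma hasSum_cos (a : ℝ) {t : ℝ} (ht : 0 < t) :
    HasSum (fun n : ℤ => cos (2 * π * a * n) * exp (-(π * t * n ^ 2)))
      (HurwitzZeta.cosKernel a t) := by
  have := Complex.hasSum_re (HurwitzZeta.hasSum_int_cosKernel a ht)
  rw [Complex.ofReal_re] at this
  refine this.congr_fun fun n => ?_
  rw [Complex.re_mul_ofReal]
  have : (2 * π * Complex.I * a * n : ℂ) = ((2 * π * a * n : ℝ) : ℂ) * Complex.I := by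
    push_cast; ring
  rw [this, Complex.exp_ofReal_mul_I_re]
  congr 2; ring

lemma hasSum_even (a : ℝ) {t : ℝ} (ht : 0 < t) :
    HasSum (fun n : ℤ => exp (-(π * t * (n + a) ^ 2)))
      ((√t)⁻¹ * HurwitzZeta.cosKernel a t⁻¹) := by
  have := HurwitzZeta.hasSum_int_evenKernel a ht
  rw [HurwitzZeta.evenKernel_functional_equation, ← Real.sqrt_eq_rpow, one_div, one_div] at this
  convert this using 3
  ring

/-- The Poisson transform of `theta`. -/
noncomputable def gT (x P Q : ℝ) (v : ℤ × ℤ) : ℝ :=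
  cos (2 * π * (v.1 * x) * v.2) * exp (-(π * Q * v.2 ^ 2)) * exp (-(π * P * v.1 ^ 2))

lemma gauss_sq_le (n : ℤ) {c : ℝ} (hc : 0 ≤ c) : exp (-(c * (n:ℝ) ^ 2)) ≤ exp (-(c * |(n:ℝ)|)) := by
  rw [exp_le_exp]
  have h1 : |n| ≤ n ^ 2 := by rw [← sq_abs]; exact Int.le_self_sq _
  have h : |(n:ℝ)| ≤ (n:ℝ) ^ 2 := by exact_mod_cast h1
  nlinarith

lemma summable_gT {x P Q : ℝ} (hP : 0 < P) (hQ : 0 < Q) : Summable (gT x P Q) := by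
  have h1 : 0 < min (π * P) (π * Q) := by positivity
  refine Summable.of_norm_bounded (g := maj (min (π * P) (π * Q))) (summable_maj h1) fun v => ?_
  have e1 := gauss_sq_le v.1 (c := π * P) (by positivity)
  have e2 := gauss_sq_le v.2 (c := π * Q) (by positivity)
  rw [gT, norm_mul, norm_mul, norm_of_nonneg (exp_pos _).le, norm_of_nonneg (exp_pos _).le, maj]
  have hc : ‖cos (2 * π * (v.1 * x) * v.2)‖ ≤ 1 := abs_cos_le_one _
  calc _ ≤ 1 * exp (-(π * Q * |(v.2:ℝ)|)) * exp (-(π * P * |(v.1:ℝ)|)) := by gcongr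
    _ ≤ _ := by
      rw [one_mul, ← exp_add, exp_le_exp]
      have a1 := mul_le_mul_of_nonneg_right (min_le_left (π * P) (π * Q)) (abs_nonneg (v.1:ℝ))
      have a2 := mul_le_mul_of_nonneg_right (min_le_right (π * P) (π * Q)) (abs_nonneg (v.2:ℝ))
      linarith

noncomputable def g (x P Q : ℝ) : ℝ := ∑' v, gT x P Q v

lemma g_symm (x P Q : ℝ) : g x P Q = g x Q P := by
  unfold g
  rw [← (Equiv.prodComm ℤ ℤ).tsum_eq]
  refine tsum_congr fun v => ?_
  simp only [gT, Equiv.prodComm_apply, Prod.fst_swap, Prod.snd_swap]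
  rw [mul_right_comm]; congr 3; ring

lemma hasSum_g {x P Q : ℝ} (hP : 0 < P) (hQ : 0 < Q) :
    HasSum (fun m : ℤ => HurwitzZeta.cosKernel ((m * x : ℝ) : UnitAddCircle) Q
      * exp (-(π * P * m ^ 2))) (g x P Q) := by
  refine (summable_gT (x := x) hP hQ).hasSum.prod_fiberwise fun m => ?_
  exact (hasSum_cos (m * x) hQ).mul_right _

lemma theta_eq {α x y : ℝ} (hα : 0 < α) (hy : 0 < y) :
    theta α x y = √(y / α) * g x (α * y) (y / α) := by
  have h := (summable_theta (x := x) hy hα).hasSum.prod_fiberwise (fun m : ℤ =>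
    ((hasSum_even (m * x) (show 0 < α / y by positivity)).mul_right
      (exp (-(π * (α * y) * m ^ 2)))).congr_fun fun n => by
        rw [← exp_add]; congr 1; unfold N; ring)
  have h2 := (hasSum_g (x := x) (show 0 < α * y by positivity)
    (show 0 < y / α by positivity)).mul_left (√(y / α))
  refine HasSum.unique h (h2.congr_fun fun m => ?_)
  rw [← Real.sqrt_inv, inv_div]; ring

lemma theta_dual {α x y : ℝ} (hα : 0 < α) (hy : 0 < y) :
    theta α⁻¹ x y = α * theta α x y := by
  rw [theta_eq hα hy, theta_eq (inv_pos.2 hα) hy, g_symm, div_inv_eq_mul, inv_mul_eq_div,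
    mul_comm y α, ← mul_assoc]
  congr 1
  rw [show α * y = α ^ 2 * (y / α) by field_simp, Real.sqrt_mul (by positivity),
    Real.sqrt_sq hα.le]

end BM

namespace BM
open Real Set Filter Topology MeasureTheory

lemma abs_sin_nat_mul (k : ℕ) (φ : ℝ) : |sin (k * φ)| ≤ k * |sin φ| := by
  induction k with
  | zero => simp
  | succ k ih =>
    have : ((k + 1 : ℕ) : ℝ) * φ = k * φ + φ := by push_cast; ring
    rw [this, sin_add]
    calc _ ≤ |sin (k * φ) * cos φ| + |cos (k * φ) * sin φ| := abs_add_le _ _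
      _ = |sin (k * φ)| * |cos φ| + |cos (k * φ)| * |sin φ| := by rw [abs_mul, abs_mul]
      _ ≤ |sin (k * φ)| * 1 + 1 * |sin φ| := by
        gcongr
        · exact abs_cos_le_one _
        · exact abs_cos_le_one _
      _ ≤ _ := by push_cast; linarith

lemma sin_sq_int_mul (k : ℤ) (φ : ℝ) : sin (k * φ) ^ 2 ≤ (k:ℝ) ^ 2 * sin φ ^ 2 := by
  have h := abs_sin_nat_mul k.natAbs φ
  have h2 : sin (k.natAbs * φ) ^ 2 ≤ ((k.natAbs : ℝ) * |sin φ|) ^ 2 := by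
    rw [← sq_abs (sin (k.natAbs * φ))]
    gcongr
  rw [mul_pow, sq_abs, Nat.cast_natAbs, Int.cast_abs, sq_abs] at h2
  rcases abs_choice (k:ℝ) with h3 | h3 <;> rw [h3] at h2
  · exact h2
  · rwa [neg_mul, sin_neg, neg_sq] at h2

lemma cos_int_pi_abs (k : ℤ) : |cos (k * π)| = 1 := abs_cos_int_mul_pi k

/-- The basic trigonometric identity. -/
lemma cos_diff (k : ℤ) (d : ℝ) :
    cos (2 * π * k * (1 / 2 - d)) - cos (k * π) = -2 * cos (k * π) * sin (k * (π * d)) ^ 2 := by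
  have e : 2 * π * k * (1 / 2 - d) = k * π - 2 * (k * (π * d)) := by ring
  rw [e, cos_sub, sin_int_mul_pi, cos_two_mul, cos_sq']; ring

noncomputable def mom (Q : ℝ) : ℝ := ∑' n : ℤ, (n:ℝ) ^ 2 * exp (-(π * Q * n ^ 2))

lemma mom_term {Q : ℝ} (n : ℤ) : (n:ℝ) ^ 2 * exp (-(π * Q * n ^ 2))
    = (fun k : ℕ => (k:ℝ) ^ 2 * exp (-(π * Q)) ^ (k ^ 2)) n.natAbs := by
  dsimp only
  rw [← exp_nat_mul]; push_cast
  rw [Nat.cast_natAbs, Int.cast_abs, sq_abs]; congr 2; ring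

lemma summable_mom {Q : ℝ} (hQ : 0 < Q) :
    Summable fun n : ℤ => (n:ℝ) ^ 2 * exp (-(π * Q * n ^ 2)) := by
  have h : Summable fun k : ℕ => (k:ℝ) ^ 2 * exp (-(π * Q)) ^ k :=
    summable_pow_mul_geometric_of_norm_lt_one 2 (by
      rw [norm_of_nonneg (exp_pos _).le]; simp; positivity)
  have h2 : Summable fun k : ℕ => (k:ℝ) ^ 2 * exp (-(π * Q)) ^ (k ^ 2) := by
    refine Summable.of_nonneg_of_le (fun _ => by positivity) (fun k => ?_) h
    gcongr ?_ * ?_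
    apply pow_le_pow_of_le_one (exp_pos _).le
    · simp; positivity
    · exact Nat.le_self_pow two_ne_zero k
  exact (hasSum_natAbs h2.hasSum).summable.congr fun n => (mom_term n).symm

lemma mom_bound {Q : ℝ} (hQ : 0 < Q) (hq : exp (-(π * Q)) ≤ 57 / 100) :
    mom Q ≤ 2 * exp (-(π * Q)) * (1 + 14 / 3 * exp (-(π * Q)) ^ 3) := by
  set q := exp (-(π * Q)) with hqdef
  have q0 : 0 < q := exp_pos _
  set u : ℕ → ℝ := fun k => (k:ℝ) ^ 2 * q ^ (k ^ 2) with hu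
  have key : ∀ k : ℕ, u (k + 2) ≤ 4 * q ^ 4 * (1 / 7) ^ k := by
    intro k
    induction k with
    | zero => simp [hu]; norm_num
    | succ k ih =>
      have e : u (k + 1 + 2) = ((k + 3 : ℝ) / (k + 2)) ^ 2 * q ^ (2 * k + 5) * u (k + 2) := by
        simp only [hu]; push_cast
        have : (k + 1 + 2) ^ 2 = (2 * k + 5) + (k + 2) ^ 2 := by ring
        rw [this, pow_add]; field_simp; ring
      have h1 : ((k + 3 : ℝ) / (k + 2)) ^ 2 ≤ (3 / 2) ^ 2 := by
        refine pow_le_pow_left₀ (by positivity) ?_ 2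
        rw [div_le_div_iff₀ (by positivity) (by norm_num)]
        nlinarith [(Nat.cast_nonneg k : (0:ℝ) ≤ k)]
      have h2 : q ^ (2 * k + 5) ≤ (57 / 100) ^ 5 := by
        calc q ^ (2 * k + 5) ≤ q ^ 5 := pow_le_pow_of_le_one q0.le (by linarith) (by omega)
          _ ≤ _ := by gcongr
      have hun : 0 ≤ u (k + 2) := by simp only [hu]; positivity
      rw [e]
      calc _ ≤ (3 / 2 : ℝ) ^ 2 * (57 / 100) ^ 5 * (4 * q ^ 4 * (1 / 7) ^ k) := by gcongr
        _ ≤ (1 / 7) * (4 * q ^ 4 * (1 / 7) ^ k) := by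
          have : 0 ≤ 4 * q ^ 4 * (1 / 7 : ℝ) ^ k := by positivity
          gcongr; norm_num
        _ = _ := by ring
  have hgeo : HasSum (fun k : ℕ => 4 * q ^ 4 * (1 / 7 : ℝ) ^ k) (4 * q ^ 4 * (1 - 1 / 7)⁻¹) :=
    (hasSum_geometric_of_lt_one (by norm_num) (by norm_num)).mul_left _
  have hs2 : Summable fun k => u (k + 2) :=
    Summable.of_nonneg_of_le (fun k => by simp only [hu]; positivity) key hgeo.summable
  have hle : ∑' k, u (k + 2) ≤ 4 * q ^ 4 * (1 - 1 / 7)⁻¹ := hasSum_le key hs2.hasSum hgeo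
  have hs : HasSum u (q + ∑' k, u (k + 2)) := by
    have := (hasSum_nat_add_iff (f := u) 2).1 hs2.hasSum
    have e : ∑ i ∈ Finset.range 2, u i = q := by simp [Finset.sum_range_succ, hu]
    rwa [e, add_comm] at this
  have ht := hasSum_natAbs hs
  have : mom Q = (q + ∑' k, u (k + 2)) + ((q + ∑' k, u (k + 2)) - u 0) :=
    (ht.congr_fun fun n => mom_term n).tsum_eq
  rw [this]
  have h0 : u 0 = 0 := by simp [hu]
  rw [h0]
  norm_num at hle
  nlinarith [hle]

lemma mom_bound2 {Q : ℝ} (hQ : 0 < Q) : mom Q ≤ (π / Q) ^ 2 := by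
  have hz := hasSum_natAbs hasSum_zeta_two
  have : ∀ n : ℤ, (n:ℝ) ^ 2 * exp (-(π * Q * n ^ 2)) ≤ 2 / (π * Q) ^ 2 * (1 / (n.natAbs : ℝ) ^ 2) := by
    intro n
    rw [Nat.cast_natAbs, Int.cast_abs, sq_abs]
    rcases eq_or_ne n 0 with rfl | hn
    · simp
    · have hn' : (0:ℝ) < (n:ℝ) ^ 2 := by positivity
      have h := quadratic_le_exp_of_nonneg (x := π * Q * n ^ 2) (by positivity)
      rw [exp_neg, ← div_eq_mul_inv, div_le_iff₀ (exp_pos _)]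
      have h3 : (π * Q * n ^ 2) ^ 2 / 2 ≤ exp (π * Q * n ^ 2) := by
        have : 0 ≤ π * Q * n ^ 2 := by positivity
        linarith
      calc (n:ℝ) ^ 2 = 2 / (π * Q) ^ 2 * (1 / n ^ 2) * ((π * Q * n ^ 2) ^ 2 / 2) := by
            field_simp
        _ ≤ _ := by gcongr
  have h := hasSum_le this (summable_mom hQ).hasSum (hz.mul_left _)
  have h2 : mom Q ≤ _ := h
  refine h2.trans ?_
  simp only [Nat.cast_zero]
  have hp : (3:ℝ) < π := pi_gt_three
  have e : 2 / (π * Q) ^ 2 * (π ^ 2 / 6 + (π ^ 2 / 6 - 1 / 0 ^ 2)) = (2 / 3) / Q ^ 2 := by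
    field_simp; norm_num; ring
  rw [e, div_pow]
  gcongr
  nlinarith

end BM

namespace BM
open Real Set Filter Topology MeasureTheory

/-- Difference of theta functions at `m x` and `m / 2`, `x = 1/2 - d`. -/
noncomputable def K (d Q : ℝ) (m : ℤ) : ℝ :=
  HurwitzZeta.cosKernel ((m * (1 / 2 - d) : ℝ) : UnitAddCircle) Q
    - HurwitzZeta.cosKernel ((m * (1 / 2) : ℝ) : UnitAddCircle) Q

lemma hasSum_K (d : ℝ) {Q : ℝ} (hQ : 0 < Q) (m : ℤ) :
    HasSum (fun n : ℤ => -2 * cos ((m * n : ℤ) * π) * sin ((m * n : ℤ) * (π * d)) ^ 2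
      * exp (-(π * Q * n ^ 2))) (K d Q m) := by
  refine ((hasSum_cos (m * (1 / 2 - d)) hQ).sub (hasSum_cos (m * (1 / 2)) hQ)).congr_fun
    fun n => ?_
  rw [← cos_diff, ← sub_mul]
  have e1 : 2 * π * ((m * n : ℤ) : ℝ) * (1 / 2 - d) = 2 * π * (m * (1 / 2 - d)) * n := by
    push_cast; ring
  have e2 : ((m * n : ℤ) : ℝ) * π = 2 * π * (m * (1 / 2)) * n := by push_cast; ring
  rw [e1, e2]

lemma K_zero (d Q : ℝ) : K d Q 0 = 0 := by simp [K]

lemma K_neg_one (d Q : ℝ) : K d Q (-1) = K d Q 1 := by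
  unfold K
  rw [← HurwitzZeta.cosKernel_neg (((-1 : ℤ) * (1 / 2 - d) : ℝ) : UnitAddCircle),
    ← HurwitzZeta.cosKernel_neg (((-1 : ℤ) * (1 / 2) : ℝ) : UnitAddCircle),
    ← AddCircle.coe_neg, ← AddCircle.coe_neg]
  simp

lemma K_term_lower (d : ℝ) (k : ℤ) :
    -(2 * (k:ℝ) ^ 2 * sin (π * d) ^ 2) ≤ -2 * cos (k * π) * sin (k * (π * d)) ^ 2 := by
  have h1 := sin_sq_int_mul k (π * d)
  have h2 := le_abs_self (cos (k * π))
  rw [abs_cos_int_mul_pi] at h2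
  nlinarith [sq_nonneg (sin (k * (π * d)))]

lemma K_lower (d : ℝ) {Q : ℝ} (hQ : 0 < Q) (m : ℤ) :
    -(2 * (m:ℝ) ^ 2 * sin (π * d) ^ 2 * mom Q) ≤ K d Q m := by
  have h := (summable_mom hQ).hasSum.mul_left (-(2 * (m:ℝ) ^ 2 * sin (π * d) ^ 2))
  refine le_trans (le_of_eq ?_) (hasSum_le (fun n => ?_) h (hasSum_K d hQ m))
  · unfold mom; ring
  · have := mul_le_mul_of_nonneg_right (K_term_lower d (m * n)) (exp_pos (-(π * Q * (n:ℝ) ^ 2))).le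
    refine le_trans (le_of_eq ?_) this
    push_cast; ring

/-- two-point indicator -/
lemma hasSum_pm (c : ℝ) : HasSum (fun m : ℤ => if m = 1 ∨ m = -1 then c else 0) (2 * c) := by
  have h : HasSum (fun m : ℤ => if m = 1 ∨ m = -1 then c else 0)
      (∑ m ∈ ({1, -1} : Finset ℤ), if m = 1 ∨ m = -1 then c else 0) :=
    hasSum_sum_of_ne_finset_zero (by intro b hb; simp at hb; simp [hb])
  convert h using 1
  rw [Finset.sum_pair (by norm_num)]
  simp; ring

lemma K_one_lower (d : ℝ) {Q : ℝ} (hQ : 0 < Q) :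
    2 * sin (π * d) ^ 2 * (4 * exp (-(π * Q)) - mom Q) ≤ K d Q 1 := by
  have h := ((summable_mom hQ).hasSum.mul_left (-(2 * sin (π * d) ^ 2))).add
    (hasSum_pm (4 * sin (π * d) ^ 2 * exp (-(π * Q))))
  refine le_trans (le_of_eq ?_) (hasSum_le (fun n => ?_) h (hasSum_K d hQ 1))
  · unfold mom; ring
  · rw [one_mul]
    split_ifs with hn
    · rcases hn with rfl | rfl
      · simp; ring_nf; rfl
      · simp; ring_nf; rfl
    · have := mul_le_mul_of_nonneg_right (K_term_lower d n) (exp_pos (-(π * Q * (n:ℝ) ^ 2))).le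
      refine le_trans (le_of_eq ?_) this
      ring

lemma g_diff_lower {d P Q : ℝ} (hP : 0 < P) (hQ : 0 < Q) :
    2 * exp (-(π * P)) * (K d Q 1 + 2 * sin (π * d) ^ 2 * mom Q)
      - 2 * sin (π * d) ^ 2 * mom Q * mom P ≤ g (1 / 2 - d) P Q - g (1 / 2) P Q := by
  have hg := (hasSum_g (x := 1 / 2 - d) hP hQ).sub (hasSum_g (x := 1 / 2) hP hQ)
  have h := ((summable_mom hP).hasSum.mul_left (-(2 * sin (π * d) ^ 2 * mom Q))).add
    (hasSum_pm (exp (-(π * P)) * (K d Q 1 + 2 * sin (π * d) ^ 2 * mom Q)))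
  refine le_trans (le_of_eq ?_) (hasSum_le (fun m => ?_) h hg)
  · unfold mom; ring
  · rw [← sub_mul]
    change _ ≤ K d Q m * _
    split_ifs with hm
    · rcases hm with rfl | rfl
      · simp; ring_nf; rfl
      · rw [K_neg_one]; simp; ring_nf; rfl
    · have := mul_le_mul_of_nonneg_right (K_lower d hQ m) (exp_pos (-(π * P * (m:ℝ) ^ 2))).le
      refine le_trans (le_of_eq ?_) this
      ring

/-- lower bound in the small `Q` regime -/
lemma K_one_lower2 {d Q : ℝ} (hQ : 0 < Q) (hd : 0 ≤ d) (hd2 : d ≤ 1 / 2)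
    (hc : 16 ≤ π / Q) :
    (√Q)⁻¹ * (exp (-(π / Q / 4)) * (d ^ 2 * ((π / Q) ^ 2 / 8 - 2 * (π / Q)))) ≤ K d Q 1 := by
  set c := π / Q with hcdef
  have hQi : 0 < Q⁻¹ := inv_pos.2 hQ
  have h1 := hasSum_even (1 / 2 - d) hQi
  have h2 := hasSum_even (1 / 2) hQi
  rw [Real.sqrt_inv, inv_inv, inv_inv] at h1 h2
  -- reflect
  have h1' : HasSum (fun n : ℤ => exp (-(π * Q⁻¹ * (n + 1 / 2 + d) ^ 2)))
      (√Q * HurwitzZeta.cosKernel ((1 / 2 - d : ℝ) : UnitAddCircle) Q) := by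
    have := (Equiv.subLeft (-1 : ℤ)).hasSum_iff.2 h1
    refine this.congr_fun fun n => ?_
    simp only [Function.comp, Equiv.subLeft_apply]
    congr 3; push_cast; ring
  have h3 := (h1.add h1').sub (h2.mul_left 2)
  have hpi : π * Q⁻¹ = c := by rw [hcdef]; ring
  simp only [hpi] at h3
  have base : 2 * (d ^ 2 * (c ^ 2 / 16 - c)) ≤ 2 * (exp (-(c * d ^ 2)) * cosh (c * d)) - 2 := by
    have e : 2 * (exp (-(c * d ^ 2)) * cosh (c * d))
        = exp (c * d * (1 - d)) + exp (-(c * d * (1 + d))) := by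
      rw [cosh_eq, ← mul_div_assoc, mul_div_cancel₀ _ two_ne_zero, mul_add, ← exp_add, ← exp_add]
      congr 2 <;> ring
    rw [e]
    have ha := quadratic_le_exp_of_nonneg (x := c * d * (1 - d)) (by
      apply mul_nonneg (by positivity); linarith)
    have hb := add_one_le_exp (-(c * d * (1 + d)))
    have h4 : (c * d) ^ 2 * (1 / 2) ^ 2 ≤ (c * d) ^ 2 * (1 - d) ^ 2 := by
      apply mul_le_mul_of_nonneg_left _ (by positivity)
      apply pow_le_pow_left₀ (by norm_num); linarith
    nlinarith
  have hb0 : 0 ≤ d ^ 2 * (c ^ 2 / 16 - c) := by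
    apply mul_nonneg (by positivity); nlinarith
  have hT : ∀ n : ℤ, exp (-(c * (n + (1 / 2 - d)) ^ 2)) + exp (-(c * (n + 1 / 2 + d) ^ 2))
      - 2 * exp (-(c * (n + 1 / 2) ^ 2))
      = exp (-(c * (n + 1 / 2) ^ 2)) *
        (2 * (exp (-(c * d ^ 2)) * cosh (2 * c * (n + 1 / 2) * d)) - 2) := by
    intro n
    rw [cosh_eq, ← mul_div_assoc, mul_div_cancel₀ _ two_ne_zero, mul_add, mul_sub, mul_add,
      ← exp_add, ← exp_add, ← exp_add, ← exp_add]
    rw [mul_comm (exp _) 2]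
    congr 3 <;> ring
  have hcosh : ∀ n : ℤ, cosh (c * d) ≤ cosh (2 * c * (n + 1 / 2) * d) := by
    intro n
    rw [cosh_le_cosh]
    have : (1:ℝ) ≤ |2 * (n:ℝ) + 1| := by
      have : (1:ℤ) ≤ |2 * n + 1| := by
        apply Int.one_le_abs; omega
      exact_mod_cast this
    rw [show 2 * c * ((n:ℝ) + 1 / 2) * d = (2 * n + 1) * (c * d) by ring, abs_mul (2 * (n:ℝ) + 1)]
    nlinarith [abs_nonneg (c * d)]
  have hlow : ∀ n : ℤ, exp (-(c * (n + 1 / 2) ^ 2)) * (2 * (d ^ 2 * (c ^ 2 / 16 - c))) ≤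
      exp (-(c * (n + (1 / 2 - d)) ^ 2)) + exp (-(c * (n + 1 / 2 + d) ^ 2))
      - 2 * exp (-(c * (n + 1 / 2) ^ 2)) := by
    intro n
    rw [hT]
    gcongr
    refine base.trans ?_
    gcongr
    exact hcosh n
  have hfin := sum_le_hasSum ({0, -1} : Finset ℤ) (fun n _ => le_trans (by positivity) (hlow n)) h3
  rw [Finset.sum_pair (by norm_num)] at hfin
  have e0 := hlow 0
  have e1 := hlow (-1)
  have p0 : exp (-(c * (((0:ℤ):ℝ) + 1 / 2) ^ 2)) = exp (-(c / 4)) := by congr 1; push_cast; ring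
  have p1 : exp (-(c * (((-1:ℤ):ℝ) + 1 / 2) ^ 2)) = exp (-(c / 4)) := by congr 1; push_cast; ring
  rw [p0] at e0 hfin
  rw [p1] at e1 hfin
  have hK : √Q * K d Q 1 = √Q * HurwitzZeta.cosKernel ((1 / 2 - d : ℝ) : UnitAddCircle) Q
      - √Q * HurwitzZeta.cosKernel ((1 / 2 : ℝ) : UnitAddCircle) Q := by
    unfold K; simp only [Int.cast_one, one_mul]; ring
  rw [inv_mul_le_iff₀ (by positivity), hK]
  have := add_le_add e0 e1
  have := this.trans hfin
  nlinarith

set_option maxHeartbeats 2000000 in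
lemma g_step {d P Q : ℝ} (hd : 0 < d) (hd2 : d ≤ 1 / 2) (hP : √3 / 2 ≤ P) (hQ : 0 < Q)
    (hPQ : 3 / 4 ≤ P * Q) : g (1 / 2) P Q < g (1 / 2 - d) P Q := by
  have h3 : (1.73:ℝ) < √3 := by
    rw [Real.lt_sqrt (by norm_num)]; norm_num
  have hP0 : 0 < P := by linarith
  have hpi : (3.14:ℝ) < π := pi_gt_d2
  have hpi2 : π < (3.15:ℝ) := pi_lt_d2
  have hg := g_diff_lower (d := d) hP0 hQ
  set S := sin (π * d) ^ 2 with hS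
  have hsin : 0 < sin (π * d) := sin_pos_of_pos_of_lt_pi (by positivity) (by nlinarith)
  have hS0 : 0 < S := by positivity
  set p := exp (-(π * P)) with hp
  have p0 : 0 < p := exp_pos _
  have hp1 : p ≤ 1 / 10 := by
    rw [hp, exp_neg, inv_le_comm₀ (exp_pos _) (by norm_num)]
    have h1 : exp (27/10) ≤ exp (π * P) := by rw [exp_le_exp]; nlinarith
    have h2 := sum_le_exp_of_nonneg (x := (27/10:ℝ)) (by norm_num) 5
    norm_num [Finset.sum_range_succ, Nat.factorial] at h2
    rw [one_div, inv_inv]; linarith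
  have hmP := mom_bound hP0 (hp1.trans (by norm_num))
  rw [← hp] at hmP
  have hM0 : 0 ≤ mom Q := tsum_nonneg fun n => by positivity
  -- it suffices
  suffices hK : 2 * S * mom Q * (14 / 3 * p ^ 3) < K d Q 1 by
    have h5 : 2 * S * mom Q * mom P ≤ 2 * S * mom Q * (2 * p * (1 + 14 / 3 * p ^ 3)) := by
      gcongr
    have h6 : 0 < 2 * p * (K d Q 1 - 2 * S * mom Q * (14 / 3 * p ^ 3)) := by
      apply mul_pos (by positivity); linarith
    nlinarith
  rcases le_total (9 / 50) Q with h | h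
  · set q := exp (-(π * Q)) with hq
    have q0 : 0 < q := exp_pos _
    have hq1 : q ≤ 57 / 100 := by
      rw [hq, exp_neg, inv_le_comm₀ (exp_pos _) (by norm_num)]
      have h1 : exp (113/200) ≤ exp (π * Q) := by rw [exp_le_exp]; nlinarith
      have h2 := sum_le_exp_of_nonneg (x := (113/200:ℝ)) (by norm_num) 5
      norm_num [Finset.sum_range_succ, Nat.factorial] at h2
      norm_num only [inv_div]; linarith
    have hmQ := mom_bound hQ hq1
    rw [← hq] at hmQ
    have hq3 : q ^ 3 ≤ (57 / 100) ^ 3 := by gcongr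
    have hp3 : p ^ 3 ≤ (1 / 10) ^ 3 := by gcongr
    have hmQ2 : mom Q ≤ 3.74 * q := by
      refine hmQ.trans ?_
      norm_num at hq3 ⊢
      nlinarith
    have hK := K_one_lower d hQ
    rw [← hS, ← hq] at hK
    refine lt_of_lt_of_le ?_ hK
    rw [mul_assoc (2 * S)]
    apply mul_lt_mul_of_pos_left _ (by positivity)
    have : mom Q * (14 / 3 * p ^ 3) ≤ 3.74 * q * (14 / 3 * (1 / 10) ^ 3) := by gcongr
    norm_num at this hmQ2 ⊢
    linarith
  · have hc : 17.4 ≤ π / Q := by rw [le_div_iff₀ hQ]; nlinarith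
    have hK := K_one_lower2 hQ hd.le hd2 (by linarith)
    refine lt_of_lt_of_le ?_ hK
    have hM := mom_bound2 hQ
    set c := π / Q with hcdef
    have hc0 : 0 < c := by positivity
    have hsq : 1 ≤ (√Q)⁻¹ := by
      rw [one_le_inv₀ (by positivity)]
      exact Real.sqrt_le_one.2 (by linarith)
    have hS2 : S ≤ 10 * d ^ 2 := by
      have : sin (π * d) ≤ π * d := sin_le (by positivity)
      calc S ≤ (π * d) ^ 2 := by rw [hS]; gcongr
        _ = π ^ 2 * d ^ 2 := by ring
        _ ≤ 10 * d ^ 2 := by gcongr; nlinarith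
    have hp3 : p ^ 3 ≤ exp (-(c / 4)) * exp (-(2 * c)) := by
      rw [hp, ← exp_nat_mul, ← exp_add, exp_le_exp]
      have : 3 / 4 * c ≤ π * P := by
        rw [hcdef, mul_div_assoc', div_le_iff₀ hQ]; nlinarith
      push_cast; linarith
    have he : c ^ 2 * exp (-(2 * c)) ≤ 1 / 200 := by
      have h2 := sum_le_exp_of_nonneg (x := 2 * c) (by positivity) 5
      rw [exp_neg, ← div_eq_mul_inv, div_le_iff₀ (exp_pos _)]
      norm_num [Finset.sum_range_succ, Nat.factorial] at h2
      have h3 : (17.4:ℝ) ^ 2 ≤ c ^ 2 := by gcongr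
      have : 200 * c ^ 2 ≤ (2 * c) ^ 4 / 24 := by nlinarith [sq_nonneg c]
      have h5 : 0 ≤ (2 * c) ^ 3 := by positivity
      nlinarith
    have hE := exp_pos (-(c / 4))
    have hcc : 280 / 3 * (1 / 200) < c ^ 2 / 8 - 2 * c := by
      have : c ^ 2 / 8 - 2 * c = c * (c / 8 - 2) := by ring
      rw [this]
      have h9 : 0.175 ≤ c / 8 - 2 := by linarith
      have : 17.4 * 0.175 ≤ c * (c / 8 - 2) := by gcongr
      linarith
    have hd3 : 0 < d ^ 2 := by positivity
    calc 2 * S * mom Q * (14 / 3 * p ^ 3)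
        ≤ 2 * (10 * d ^ 2) * c ^ 2 * (14 / 3 * (exp (-(c / 4)) * exp (-(2 * c)))) := by gcongr
      _ = exp (-(c / 4)) * (d ^ 2 * (280 / 3 * (c ^ 2 * exp (-(2 * c))))) := by ring
      _ ≤ exp (-(c / 4)) * (d ^ 2 * (280 / 3 * (1 / 200))) := by gcongr
      _ < exp (-(c / 4)) * (d ^ 2 * (c ^ 2 / 8 - 2 * c)) :=
        mul_lt_mul_of_pos_left (mul_lt_mul_of_pos_left hcc hd3) hE
      _ ≤ _ := le_mul_of_one_le_left (mul_nonneg hE.le (mul_nonneg hd3.le (by linarith))) hsq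

lemma g_abs (x P Q : ℝ) : g |x| P Q = g x P Q := by
  rcases abs_choice x with h | h <;> rw [h]
  unfold g gT
  refine tsum_congr fun v => ?_
  congr 2
  rw [← cos_neg]; congr 1; ring

lemma x_step {α x y : ℝ} (hα : 1 ≤ α) (hy : √3 / 2 ≤ y) (hx : |x| < 1 / 2) :
    theta α (1 / 2) y < theta α x y := by
  have h3 : 0 < √3 := by positivity
  have hy0 : 0 < y := by linarith
  have hα0 : 0 < α := by linarith
  rw [theta_eq hα0 hy0, theta_eq hα0 hy0]
  apply mul_lt_mul_of_pos_left _ (by positivity)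
  have := g_step (d := 1 / 2 - |x|) (P := α * y) (Q := y / α) (by linarith)
    (by linarith [abs_nonneg x]) (by nlinarith) (by positivity) (by
      have : α * y * (y / α) = y ^ 2 := by field_simp
      rw [this]
      have : (√3 / 2) ^ 2 ≤ y ^ 2 := by gcongr
      rw [div_pow, Real.sq_sqrt (by norm_num)] at this
      linarith)
  rwa [sub_sub_cancel, g_abs] at this

end BM

namespace BM
open Real Set Filter Topology MeasureTheory

lemma sqrt3_gt : (1.732:ℝ) < √3 := by rw [Real.lt_sqrt (by norm_num)]; norm_num
lemma sqrt3_lt : √3 < (1.7321:ℝ) := by rw [Real.sqrt_lt' (by norm_num)]; norm_num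

/-- Tangent line inequality. -/
lemma tangent_le {f df ddf : ℝ → ℝ} {s s0 : ℝ} (hs : 0 < s) (hss : s ≤ s0)
    (h1 : ∀ u, 0 < u → HasDerivAt f (df u) u) (h2 : ∀ u, 0 < u → HasDerivAt df (ddf u) u)
    (h3 : ∀ u, 0 < u → u ≤ s0 → 0 ≤ ddf u) : f s0 + df s0 * (s - s0) ≤ f s := by
  rcases hss.eq_or_lt with rfl | hlt
  · simp
  obtain ⟨x, hx, he⟩ := exists_hasDerivAt_eq_slope f df hlt
    (fun u hu => (h1 u (hs.trans_le hu.1)).continuousAt.continuousWithinAt)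
    (fun u hu => h1 u (hs.trans hu.1))
  obtain ⟨z, hz, he2⟩ := exists_hasDerivAt_eq_slope df ddf hx.2
    (fun u hu => (h2 u ((hs.trans hx.1).trans_le hu.1)).continuousAt.continuousWithinAt)
    (fun u hu => h2 u ((hs.trans hx.1).trans hu.1))
  have h4 := h3 z ((hs.trans hx.1).trans hz.1) hz.2.le
  rw [he2] at h4
  have h5 : 0 < s0 - x := by linarith [hx.2]
  rw [le_div_iff₀ h5] at h4
  rw [eq_div_iff (by linarith)] at he
  nlinarith [sub_pos.2 hlt]

/-- One term of the theta series along `x = 1/2`, as a function of `s = 1/y`; `c = π α`. -/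
noncomputable def ph (c a b s : ℝ) : ℝ := exp (-(c * (a / s + b * s)))

lemma ph_deriv (c a b : ℝ) {s : ℝ} (hs : 0 < s) :
    HasDerivAt (ph c a b) (-(c * (b - a / s ^ 2)) * ph c a b s) s := by
  have h1 : HasDerivAt (fun s : ℝ => -(c * (a / s + b * s))) (-(c * (b - a / s ^ 2))) s := by
    have e1 : HasDerivAt (fun s : ℝ => a / s) (-a / s ^ 2) s := by
      refine ((hasDerivAt_inv hs.ne').const_mul a).congr_deriv ?_
      field_simp
    have e2 : HasDerivAt (fun s : ℝ => b * s) b s := by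
      simpa using (hasDerivAt_id s).const_mul b
    refine (((e1.add e2).const_mul c).neg).congr_deriv ?_
    field_simp; ring
  refine h1.exp.congr_deriv ?_
  unfold ph; ring

lemma ph_deriv2 (c a b : ℝ) {s : ℝ} (hs : 0 < s) :
    HasDerivAt (fun s => -(c * (b - a / s ^ 2)) * ph c a b s)
      ((c ^ 2 * (b - a / s ^ 2) ^ 2 - 2 * c * a / s ^ 3) * ph c a b s) s := by
  have h1 : HasDerivAt (fun s : ℝ => -(c * (b - a / s ^ 2))) (-(2 * c * a / s ^ 3)) s := by
    have e1 : HasDerivAt (fun s : ℝ => a / s ^ 2) (-2 * a / s ^ 3) s := by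
      have := (((hasDerivAt_pow 2 s).inv (by positivity)).const_mul a)
      refine this.congr_deriv ?_
      field_simp
      norm_num
      ring
    refine (((hasDerivAt_const s b).sub e1).const_mul c).neg.congr_deriv ?_
    ring
  refine (h1.mul (ph_deriv c a b hs)).congr_deriv ?_
  ring

/-- Tangent inequality for one term with a weight `w`. -/
lemma ph_tangent {α a b w s s0 : ℝ} (hs : 0 < s) (hss : s ≤ s0)
    (hw : ∀ u, 0 < u → u ≤ s0 → 2 * (π * α) * a / u ^ 3 - (π * α) ^ 2 * (b - a / u ^ 2) ^ 2
      ≤ w * (π * α) ^ 2 * exp (π * α * (a / u + (b - 1) * u))) :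
    -(w * (ph (π * α) 0 1 s - ph (π * α) 0 1 s0 + π * α * ph (π * α) 0 1 s0 * (s - s0)))
      ≤ ph (π * α) a b s - ph (π * α) a b s0
        + π * α * (b - a / s0 ^ 2) * ph (π * α) a b s0 * (s - s0) := by
  set c := π * α
  have h := tangent_le (f := fun u => ph c a b u + w * ph c 0 1 u)
    (df := fun u => -(c * (b - a / u ^ 2)) * ph c a b u
      + w * (-(c * (1 - 0 / u ^ 2)) * ph c 0 1 u))
    (ddf := fun u => (c ^ 2 * (b - a / u ^ 2) ^ 2 - 2 * c * a / u ^ 3) * ph c a b u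
      + w * ((c ^ 2 * (1 - 0 / u ^ 2) ^ 2 - 2 * c * 0 / u ^ 3) * ph c 0 1 u)) hs hss
    (fun u hu => (ph_deriv c a b hu).add ((ph_deriv c 0 1 hu).const_mul w))
    (fun u hu => (ph_deriv2 c a b hu).add ((ph_deriv2 c 0 1 hu).const_mul w))
    (fun u hu hu2 => by
      have h1 := hw u hu hu2
      have e : ph c 0 1 u = exp (c * (a / u + (b - 1) * u)) * ph c a b u := by
        unfold ph; rw [← exp_add]; congr 1; ring
      rw [e]
      have hp : 0 < ph c a b u := exp_pos _
      simp only [zero_div, mul_zero, sub_zero, one_pow, mul_one]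
      nlinarith)
  simp only [zero_div, sub_zero, mul_one] at h
  nlinarith

lemma cond_nu0 {α a y : ℝ} (hα : 1 ≤ α) (hy : √3 / 2 ≤ y) (ha : a = 0 ∨ 1 ≤ a) :
    2 * (π * α) * a * y ^ 3 - (π * α) ^ 2 * (0 - a * y ^ 2) ^ 2 ≤ 0 := by
  have := sqrt3_gt
  have hpi := pi_gt_d2
  have hy0 : 0.866 ≤ y := by linarith
  rcases ha with rfl | ha
  · simp
  have e : 2 * (π * α) * a * y ^ 3 - (π * α) ^ 2 * (0 - a * y ^ 2) ^ 2
     = π * α * a * y ^ 3 * (2 - π * y * (α * a)) := by ring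
  rw [e]
  apply mul_nonpos_of_nonneg_of_nonpos
  · have : 0 < y := by linarith
    positivity
  · have h1 : 2 ≤ π * y := by nlinarith
    have h2 : 1 ≤ α * a := one_le_mul_of_one_le_of_one_le hα ha
    nlinarith

/-- removing `α` -/
lemma alpha_mono {α z e w k : ℝ} (hα : 1 ≤ α) (hw : 0 ≤ w) (he : 0 ≤ e) 
    (h : k * z ≤ w * π * exp (π * e)) (hk : 0 ≤ k * z) :
    k * (π * α) * z ≤ w * (π * α) ^ 2 * exp (π * α * e) := by
  have h1 : exp (π * e) ≤ exp (π * α * e) := by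
    rw [exp_le_exp]
    have : π * e ≤ π * e * α := le_mul_of_one_le_right (by positivity) hα
    linarith
  have hp := pi_pos
  calc k * (π * α) * z = (π * α) * (k * z) := by ring
    _ ≤ (π * α) * (w * π * exp (π * α * e)) := by
      exact mul_le_mul_of_nonneg_left (h.trans (by gcongr)) (by positivity)
    _ ≤ (π * α) * (w * (π * α) * exp (π * α * e)) := by
      gcongr
      exact le_mul_of_one_le_right hp.le hα
    _ = _ := by ring

lemma cond_c {α y : ℝ} (hα : 1 ≤ α) (hy : √3 / 2 ≤ y) :
    2 * (π * α) * 1 * y ^ 3 - (π * α) ^ 2 * (1 / 4 - 1 * y ^ 2) ^ 2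
      ≤ 0.26 * (π * α) ^ 2 * exp (π * α * (1 * y + (1 / 4 - 1) / y)) := by
  have hs3 := sqrt3_gt
  have hpi := pi_gt_d2
  have hy0 : 0.866 ≤ y := by linarith
  have hyp : 0 < y := by linarith
  have hy2 : 3 / 4 ≤ y ^ 2 := by
    have : (√3 / 2) ^ 2 ≤ y ^ 2 := by gcongr
    rw [div_pow, Real.sq_sqrt (by norm_num)] at this
    linarith
  have h1 : (2 / 3 * y ^ 2) ^ 2 ≤ (1 / 4 - 1 * y ^ 2) ^ 2 := by
    rw [← neg_sq (1 / 4 - 1 * y ^ 2)]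
    apply pow_le_pow_left₀ (by positivity); linarith
  have h2 : 2 * (π * α) * 1 * y ^ 3 - (π * α) ^ 2 * (1 / 4 - 1 * y ^ 2) ^ 2
      ≤ 0.8 * (π * α) * y ^ 3 := by
    have e : (π * α) ^ 2 * (2 / 3 * y ^ 2) ^ 2 ≤ (π * α) ^ 2 * (1 / 4 - 1 * y ^ 2) ^ 2 := by gcongr
    have h3 : 1.2 ≤ 4 / 9 * (π * α * y) := by
      have : π * y ≤ π * y * α := le_mul_of_one_le_right (by positivity) hα
      nlinarith
    have h4 : 0 ≤ π * α * y ^ 3 := by positivity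
    have h5 := mul_le_mul_of_nonneg_left h3 h4
    nlinarith
  refine h2.trans ?_
  have he : 0 ≤ 1 * y + (1 / 4 - 1) / y := by
    have : 1 * y + (1 / 4 - 1) / y = (y ^ 2 - 3 / 4) / y := by field_simp; ring
    rw [this]; apply div_nonneg _ hyp.le; linarith
  refine alpha_mono hα (by norm_num) he ?_ (by positivity)
  set e := 1 * y + (1 / 4 - 1) / y with hedef
  have h6 : (1 + π * e / 3) ^ 3 ≤ exp (π * e) := by
    have : exp (π * e) = exp (π * e / 3) ^ 3 := by rw [← exp_nat_mul]; congr 1; push_cast; ring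
    rw [this]
    apply pow_le_pow_left₀ (by positivity)
    linarith [add_one_le_exp (π * e / 3)]
  have h7 : y ≤ 1 + π * e / 3 := by
    have h8 : e ≤ π * e / 3 := by nlinarith
    have : y - 1 ≤ e := by
      rw [hedef]
      have : 3 / 4 ≤ y := by linarith
      have : (3 / 4) / y ≤ 1 := by rw [div_le_one hyp]; exact this
      have e3 : (1 / 4 - 1) / y = - ((3 / 4) / y) := by ring
      rw [e3]; linarith
    linarith
  have h8 : y ^ 3 ≤ exp (π * e) := le_trans (by gcongr) h6
  have h9 : 0 < exp (π * e) := exp_pos _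
  nlinarith

set_option maxHeartbeats 2000000 in
lemma cond_d {α y : ℝ} (a b : ℕ) (hα : 1 ≤ α) (hy : √3 / 2 ≤ y) (ha : 1 ≤ a) (hb : 1 ≤ b) :
    2 * (π * α) * a ^ 2 * y ^ 3 - (π * α) ^ 2 * ((b:ℝ) ^ 2 / 4 - a ^ 2 * y ^ 2) ^ 2
      ≤ 24 * 0.055 ^ (a - 1) * 0.11 ^ b * (π * α) ^ 2
        * exp (π * α * (a ^ 2 * y + ((b:ℝ) ^ 2 / 4 - 1) / y)) := by
  have hs3 := sqrt3_gt
  have hpi := pi_gt_d2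
  have hpi2 := pi_lt_d2
  have hy0 : 0.866 ≤ y := by linarith
  have hyp : 0 < y := by linarith
  have hy2 : 3 / 4 ≤ y ^ 2 := by
    have : (√3 / 2) ^ 2 ≤ y ^ 2 := by gcongr
    rw [div_pow, Real.sq_sqrt (by norm_num)] at this
    linarith
  have ha' : (1:ℝ) ≤ a := by exact_mod_cast ha
  have hb' : (1:ℝ) ≤ b := by exact_mod_cast hb
  have he : 0 ≤ (a:ℝ) ^ 2 * y + ((b:ℝ) ^ 2 / 4 - 1) / y := by
    have : (a:ℝ) ^ 2 * y + ((b:ℝ) ^ 2 / 4 - 1) / y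
      = ((a:ℝ) ^ 2 * y ^ 2 + (b:ℝ) ^ 2 / 4 - 1) / y := by field_simp; ring
    rw [this]; apply div_nonneg _ hyp.le
    nlinarith [mul_nonneg (sub_nonneg.2 ha') (sq_nonneg y)]
  have h1 : 2 * (π * α) * a ^ 2 * y ^ 3 - (π * α) ^ 2 * ((b:ℝ) ^ 2 / 4 - a ^ 2 * y ^ 2) ^ 2
      ≤ 2 * (π * α) * ((a:ℝ) ^ 2 * y ^ 3) := by
    have : 0 ≤ (π * α) ^ 2 * ((b:ℝ) ^ 2 / 4 - a ^ 2 * y ^ 2) ^ 2 := by positivity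
    linarith
  refine h1.trans ?_
  refine alpha_mono hα (by positivity) he ?_ (by positivity)
  -- factor the exponential
  have hsplit : exp (π * ((a:ℝ) ^ 2 * y + ((b:ℝ) ^ 2 / 4 - 1) / y))
      = exp (π * (a ^ 2 * y / 2 + b ^ 2 / (4 * y))) * exp (π * y / 2 * (a ^ 2 - 1))
        * exp (π * (y / 2 - 1 / y)) := by
    rw [← exp_add, ← exp_add]; congr 1; field_simp; ring
  have f1 : (1 / 0.11 : ℝ) ^ (a * b) ≤ exp (π * (a ^ 2 * y / 2 + b ^ 2 / (4 * y))) := by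
    have hk : 0.707 * ((a:ℝ) * b) ≤ a ^ 2 * y / 2 + b ^ 2 / (4 * y) := by
      have : (a:ℝ) ^ 2 * y / 2 + b ^ 2 / (4 * y) = (2 * a ^ 2 * y ^ 2 + b ^ 2) / (4 * y) := by
        field_simp; ring
      rw [this, le_div_iff₀ (by positivity)]
      nlinarith [sq_nonneg (1.414 * (a * y) - b), sq_nonneg ((a:ℝ) * y)]
    have h2 : (1 / 0.11 : ℝ) ≤ exp (221 / 100) := by
      have h2 := sum_le_exp_of_nonneg (x := (221/100:ℝ)) (by norm_num) 9
      norm_num [Finset.sum_range_succ, Nat.factorial] at h2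
      norm_num only
      linarith
    calc (1 / 0.11 : ℝ) ^ (a * b) ≤ exp (221 / 100) ^ (a * b) := by gcongr
      _ = exp (a * b * (221 / 100)) := by rw [← exp_nat_mul]; push_cast; rfl
      _ ≤ _ := by
        rw [exp_le_exp]
        have : 0 ≤ (a:ℝ) * b := by positivity
        calc (a:ℝ) * b * (221 / 100) ≤ 3.14 * (0.707 * ((a:ℝ) * b)) := by linarith
          _ ≤ _ := by gcongr
  have f2 : (a:ℝ) ^ 2 * 2 ^ (a - 1) ≤ exp (π * y / 2 * (a ^ 2 - 1)) := by
    obtain ⟨k, rfl⟩ : ∃ k, a = k + 1 := ⟨a - 1, by omega⟩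
    simp only [Nat.add_sub_cancel]
    have h3 : ((k + 1 : ℕ) : ℝ) ≤ 2 ^ k := by exact_mod_cast Nat.lt_two_pow_self
    have h4 : (8:ℝ) ≤ exp (27 / 10) := by
      have h2 := sum_le_exp_of_nonneg (x := (27/10:ℝ)) (by norm_num) 5
      norm_num [Finset.sum_range_succ, Nat.factorial] at h2
      linarith
    calc ((k + 1 : ℕ) : ℝ) ^ 2 * 2 ^ k ≤ (2 ^ k) ^ 2 * 2 ^ k := by gcongr
      _ = 8 ^ k := by rw [← pow_mul, ← pow_add, mul_comm k 2, show 2 * k + k = 3 * k by ring,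
                        pow_mul]; norm_num
      _ ≤ exp (27 / 10) ^ k := by gcongr
      _ = exp (k * (27 / 10)) := by rw [← exp_nat_mul]
      _ ≤ _ := by
        rw [exp_le_exp]; push_cast
        have h5 : (27 / 10 : ℝ) ≤ π * y := by nlinarith
        have h6 : (0:ℝ) ≤ k := Nat.cast_nonneg k
        have : ((k:ℝ) + 1) ^ 2 - 1 = k * (k + 2) := by ring
        rw [this]
        have h7 := mul_le_mul_of_nonneg_left h5 h6
        have h8 : 0 ≤ (k:ℝ) * k * (π * y) := by positivity
        nlinarith
  have f3 : 2 * y ^ 3 ≤ 24 * π * exp (π * (y / 2 - 1 / y)) := by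
    have h2 : y ^ 3 ≤ 27 * exp (y - 3) := by
      have := add_one_le_exp (y / 3 - 1)
      have h3 : y / 3 ≤ exp (y / 3 - 1) := by linarith
      have h4 : (y / 3) ^ 3 ≤ exp (y / 3 - 1) ^ 3 := by gcongr
      rw [← exp_nat_mul] at h4
      have : ((3:ℕ):ℝ) * (y / 3 - 1) = y - 3 := by push_cast; ring
      rw [this] at h4
      nlinarith
    have hinv : 1 / y ≤ 1.155 := by rw [div_le_iff₀ hyp]; nlinarith
    have h5 : exp (y - 3) ≤ exp (1 / 5) * exp (π * (y / 2 - 1 / y)) := by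
      rw [← exp_add, exp_le_exp]
      have : π * (1 / y) ≤ 3.15 * 1.155 := by gcongr
      nlinarith
    have h6 : exp (1 / 5) ≤ 1.25 := by
      have := exp_bound_div_one_sub_of_interval (x := (1/5:ℝ)) (by norm_num) (by norm_num)
      norm_num at this ⊢
      exact this
    have hE := exp_pos (π * (y / 2 - 1 / y))
    nlinarith
  rw [hsplit]
  have hX : (1:ℝ) ≤ 0.11 ^ (a - 1) * 0.11 ^ b * (1 / 0.11) ^ (a * b) := by
    obtain ⟨k, rfl⟩ : ∃ k, a = k + 1 := ⟨a - 1, by omega⟩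
    obtain ⟨l, rfl⟩ : ∃ l, b = l + 1 := ⟨b - 1, by omega⟩
    simp only [Nat.add_sub_cancel]
    have : (k + 1) * (l + 1) = (k + (l + 1)) + k * l := by ring
    rw [this, pow_add (1 / 0.11 : ℝ), ← pow_add, ← mul_assoc, ← mul_pow]
    norm_num
    exact one_le_pow₀ (by norm_num)
  have hs : (0.055:ℝ) ^ (a - 1) * 2 ^ (a - 1) = 0.11 ^ (a - 1) := by
    rw [← mul_pow]; norm_num
  calc 2 * ((a:ℝ) ^ 2 * y ^ 3) = 1 * ((a:ℝ) ^ 2 * (2 * y ^ 3)) := by ring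
    _ ≤ (0.11 ^ (a - 1) * 0.11 ^ b * (1 / 0.11) ^ (a * b)) *
        ((a:ℝ) ^ 2 * (24 * π * exp (π * (y / 2 - 1 / y)))) :=
        mul_le_mul hX (mul_le_mul_of_nonneg_left f3 (by positivity)) (by positivity) (by positivity)
    _ = 24 * 0.055 ^ (a - 1) * 0.11 ^ b * π * ((1 / 0.11) ^ (a * b) * (a ^ 2 * 2 ^ (a - 1))
          * exp (π * (y / 2 - 1 / y))) := by rw [← hs]; ring
    _ ≤ _ := by
      refine mul_le_mul_of_nonneg_left ?_ (by positivity)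
      refine mul_le_mul_of_nonneg_right ?_ (exp_pos _).le
      exact mul_le_mul f1 f2 (by positivity) (exp_pos _).le

end BM

namespace BM
open Real Set Filter Topology MeasureTheory

noncomputable def wA (k : ℕ) : ℝ := if k = 1 then 1 else 0
noncomputable def wB (k : ℕ) : ℝ := if k ≤ 1 then 0 else 24 * 0.055 ^ (k - 1)
noncomputable def wV1 (k : ℕ) : ℝ :=
  if k = 0 ∨ k = 2 then 0 else if k = 1 then 0.26 else 24 * 0.11 ^ k
noncomputable def wV2 (k : ℕ) : ℝ := if k = 0 then 0 else 0.11 ^ k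

lemma wA_nonneg (k) : 0 ≤ wA k := by unfold wA; split_ifs <;> norm_num
lemma wB_nonneg (k) : 0 ≤ wB k := by unfold wB; split_ifs <;> positivity
lemma wV1_nonneg (k) : 0 ≤ wV1 k := by unfold wV1; split_ifs <;> positivity
lemma wV2_nonneg (k) : 0 ≤ wV2 k := by unfold wV2; split_ifs <;> positivity

lemma hasSum_wA : HasSum wA 1 := hasSum_ite_eq 1 1

lemma hasSum_wB : HasSum wB (24 * 0.055 / 0.945) := by
  have h : HasSum (fun k => wB (k + 2)) (24 * 0.055 / 0.945) := by
    have := (hasSum_geometric_of_lt_one (r := (0.055:ℝ)) (by norm_num) (by norm_num)).mul_left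
      (24 * 0.055)
    have e1 : (fun k => wB (k + 2)) = fun i => 24 * 0.055 * (0.055:ℝ) ^ i := by
      ext k; simp [wB, pow_succ]; try ring
    have e2 : (24 * 0.055 / 0.945 : ℝ) = 24 * 0.055 * (1 - 0.055)⁻¹ := by norm_num
    rw [e1, e2]; exact this
  have := (hasSum_nat_add_iff 2).1 h
  simpa [Finset.sum_range_succ, wB] using this

lemma hasSum_wV1 : HasSum wV1 (0.26 + 24 * 0.11 ^ 3 / 0.89) := by
  have h : HasSum (fun k => wV1 (k + 3)) (24 * 0.11 ^ 3 / 0.89) := by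
    have := (hasSum_geometric_of_lt_one (r := (0.11:ℝ)) (by norm_num) (by norm_num)).mul_left
      (24 * 0.11 ^ 3)
    have e1 : (fun k => wV1 (k + 3)) = fun i => 24 * 0.11 ^ 3 * (0.11:ℝ) ^ i := by
      ext k; simp [wV1, pow_succ]; try ring
    have e2 : (24 * 0.11 ^ 3 / 0.89 : ℝ) = 24 * 0.11 ^ 3 * (1 - 0.11)⁻¹ := by norm_num
    rw [e1, e2]; exact this
  have := (hasSum_nat_add_iff 3).1 h
  simpa [Finset.sum_range_succ, wV1, add_comm] using this

lemma hasSum_wV2 : HasSum wV2 (0.11 / 0.89) := by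
  have h : HasSum (fun k => wV2 (k + 1)) (0.11 / 0.89) := by
    have := (hasSum_geometric_of_lt_one (r := (0.11:ℝ)) (by norm_num) (by norm_num)).mul_left
      (0.11)
    have e1 : (fun k => wV2 (k + 1)) = fun i => 0.11 * (0.11:ℝ) ^ i := by
      ext k; simp [wV2, pow_succ]; try ring
    have e2 : (0.11 / 0.89 : ℝ) = 0.11 * (1 - 0.11)⁻¹ := by norm_num
    rw [e1, e2]; exact this
  have := (hasSum_nat_add_iff 1).1 h
  simpa [Finset.sum_range_succ, wV2] using this

noncomputable def wW (v : ℤ × ℤ) : ℝ :=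
  wA v.1.natAbs * wV1 v.2.natAbs + wB v.1.natAbs * wV2 v.2.natAbs

lemma wW_nonneg (v) : 0 ≤ wW v :=
  add_nonneg (mul_nonneg (wA_nonneg _) (wV1_nonneg _)) (mul_nonneg (wB_nonneg _) (wV2_nonneg _))

lemma hasSum_prod_aux {f g : ℕ → ℝ} {a b : ℝ} (hf : HasSum f a) (hg : HasSum g b)
    (hf0 : ∀ k, 0 ≤ f k) (hg0 : ∀ k, 0 ≤ g k) (f0 : f 0 = 0) (g0 : g 0 = 0) :
    HasSum (fun v : ℤ × ℤ => f v.1.natAbs * g v.2.natAbs) (4 * (a * b)) := by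
  have h1 := hasSum_natAbs hf
  have h2 := hasSum_natAbs hg
  have := h1.mul h2 (h1.summable.mul_of_nonneg h2.summable (fun _ => hf0 _) (fun _ => hg0 _))
  have e : 4 * (a * b) = (a + (a - f 0)) * (b + (b - g 0)) := by rw [f0, g0]; ring
  rw [e]; exact this

lemma hasSum_wW : HasSum wW (4 * (1 * (0.26 + 24 * 0.11 ^ 3 / 0.89))
    + 4 * (24 * 0.055 / 0.945 * (0.11 / 0.89))) :=
  (hasSum_prod_aux hasSum_wA hasSum_wV1 wA_nonneg wV1_nonneg (by simp [wA]) (by simp [wV1])).add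
    (hasSum_prod_aux hasSum_wB hasSum_wV2 wB_nonneg wV2_nonneg (by simp [wB]) (by simp [wV2]))

noncomputable def ww (v : ℤ × ℤ) : ℝ := wW (v.1, 2 * v.2 + v.1)

lemma ww_inj : Function.Injective (fun v : ℤ × ℤ => ((v.1, 2 * v.2 + v.1) : ℤ × ℤ)) := by
  rintro ⟨a, b⟩ ⟨c, d⟩ h
  simp only [Prod.mk.injEq] at h ⊢
  omega

lemma summable_ww : Summable ww := hasSum_wW.summable.comp_injective ww_inj

lemma tsum_ww : ∑' v, ww v < 2 := by
  have h : ∑' v, ww v ≤ ∑' v, wW v :=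
    tsum_comp_le_tsum_of_inj hasSum_wW.summable wW_nonneg ww_inj
  rw [hasSum_wW.tsum_eq] at h
  refine h.trans_lt ?_
  norm_num

/-- second derivative condition for all terms -/
lemma cond_all {α y : ℝ} (hα : 1 ≤ α) (hy : √3 / 2 ≤ y) (v : ℤ × ℤ) :
    2 * (π * α) * (v.1:ℝ) ^ 2 * y ^ 3
      - (π * α) ^ 2 * (((2 * v.2 + v.1 : ℤ) : ℝ) ^ 2 / 4 - (v.1:ℝ) ^ 2 * y ^ 2) ^ 2
      ≤ ww v * (π * α) ^ 2
        * exp (π * α * ((v.1:ℝ) ^ 2 * y + (((2 * v.2 + v.1 : ℤ) : ℝ) ^ 2 / 4 - 1) / y)) := by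
  obtain ⟨m, n⟩ := v
  simp only [ww]
  set j := 2 * n + m with hj
  have hpar : j.natAbs % 2 = m.natAbs % 2 := by omega
  have hm2 : (m:ℝ) ^ 2 = (m.natAbs : ℝ) ^ 2 := by rw [Nat.cast_natAbs, Int.cast_abs, sq_abs]
  have hj2 : (j:ℝ) ^ 2 = (j.natAbs : ℝ) ^ 2 := by rw [Nat.cast_natAbs, Int.cast_abs, sq_abs]
  rw [hm2, hj2]
  have hnn := wW_nonneg (m, j)
  unfold wW at hnn ⊢
  simp only at hnn ⊢
  generalize m.natAbs = a at *
  generalize j.natAbs = b at *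
  have hR : 0 ≤ (wA a * wV1 b + wB a * wV2 b) * (π * α) ^ 2
        * exp (π * α * ((a:ℝ) ^ 2 * y + ((b : ℝ) ^ 2 / 4 - 1) / y)) := by positivity
  rcases Nat.eq_zero_or_pos a with rfl | ha
  · refine le_trans ?_ hR
    have : 0 ≤ (π * α) ^ 2 * ((b:ℝ) ^ 2 / 4 - ((0:ℕ):ℝ) ^ 2 * y ^ 2) ^ 2 := by positivity
    simp at this ⊢
    exact this
  rcases Nat.eq_zero_or_pos b with rfl | hb
  · refine le_trans ?_ hR
    have := cond_nu0 (a := (a:ℝ) ^ 2) hα hy (Or.inr (one_le_pow₀ (by exact_mod_cast ha)))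
    simpa using this
  by_cases ha1 : a = 1
  · subst ha1
    have hb2 : b ≠ 2 := by omega
    by_cases hb1 : b = 1
    · subst hb1
      have := cond_c hα hy
      have e : wA 1 * wV1 1 + wB 1 * wV2 1 = 0.26 := by simp [wA, wV1, wB]
      rw [e]
      simpa using this
    · have := cond_d 1 b hα hy ha hb
      have e : wA 1 * wV1 b + wB 1 * wV2 b = 24 * 0.055 ^ (1 - 1) * 0.11 ^ b := by
        have : b ≠ 0 := by omega
        simp [wA, wV1, wB, hb1, hb2, this]
      rw [e]; exact this
  · have := cond_d a b hα hy ha hb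
    have e : wA a * wV1 b + wB a * wV2 b = 24 * 0.055 ^ (a - 1) * 0.11 ^ b := by
      have h1 : b ≠ 0 := by omega
      have h2 : ¬ a ≤ 1 := by omega
      simp [wA, wB, wV2, ha1, h1, h2]
    rw [e]; exact this

/-- term at `v`. -/
noncomputable def pv (α s : ℝ) (v : ℤ × ℤ) : ℝ :=
  ph (π * α) ((v.1:ℝ) ^ 2) (((2 * v.2 + v.1 : ℤ) : ℝ) ^ 2 / 4) s

lemma pv_eq (α y : ℝ) (v : ℤ × ℤ) : pv α y⁻¹ v = exp (-(π * α * N (1 / 2) y v)) := by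
  unfold pv ph N
  congr 2
  push_cast
  simp only [div_eq_mul_inv, inv_inv]
  ring

noncomputable def dv (α : ℝ) (v : ℤ × ℤ) : ℝ :=
  (((2 * v.2 + v.1 : ℤ) : ℝ) ^ 2 / 4 - (v.1:ℝ) ^ 2 * (3 / 4)) *
    exp (-(π * α * N (1 / 2) (√3 / 2) v))

def tau : ℤ × ℤ ≃ ℤ × ℤ where
  toFun v := (-v.1 - v.2, v.1)
  invFun v := (v.2, -v.1 - v.2)
  left_inv v := by ext <;> simp
  right_inv v := by ext <;> simp <;> ring

lemma N_hex (v : ℤ × ℤ) : N (1 / 2) (√3 / 2) v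
    = 2 / √3 * ((v.1:ℝ) ^ 2 + v.1 * v.2 + (v.2:ℝ) ^ 2) := by
  unfold N
  have h : √3 ^ 2 = 3 := Real.sq_sqrt (by norm_num)
  have h0 : √3 ≠ 0 := by positivity
  field_simp
  rw [h]; ring

lemma N_tau (v : ℤ × ℤ) : N (1 / 2) (√3 / 2) (tau v) = N (1 / 2) (√3 / 2) v := by
  rw [N_hex, N_hex]; simp [tau]; ring

lemma summable_dv {α : ℝ} (hα : 0 < α) : Summable (dv α) := by
  have h0 : (0:ℝ) < √3 / 2 := by positivity
  refine Summable.of_norm_bounded (summable_Ntheta (x := 1 / 2) h0 hα) (fun v => ?_)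
  unfold dv
  rw [norm_mul, Real.norm_eq_abs, Real.norm_eq_abs, abs_of_pos (exp_pos _)]
  refine mul_le_mul_of_nonneg_right ?_ (exp_pos _).le
  rw [N_hex]
  have h3 := sqrt3_lt
  have h1 : 1 ≤ 2 / √3 := by rw [le_div_iff₀ (by positivity)]; linarith
  have h2 : 0 ≤ (v.1:ℝ) ^ 2 + v.1 * v.2 + (v.2:ℝ) ^ 2 := by
    nlinarith [sq_nonneg ((v.1:ℝ) + v.2), sq_nonneg (v.1:ℝ), sq_nonneg (v.2:ℝ)]
  refine le_trans ?_ (le_mul_of_one_le_left h2 h1)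
  push_cast
  rw [abs_le]
  constructor <;> nlinarith [sq_nonneg ((v.1:ℝ) + 2 * v.2), sq_nonneg (v.1:ℝ)]

lemma tsum_dv {α : ℝ} (hα : 0 < α) : ∑' v, dv α v = 0 := by
  have hs := summable_dv hα
  have e1 : ∑' v, dv α (tau v) = ∑' v, dv α v := tau.tsum_eq (dv α)
  have e2 : ∑' v, dv α (tau (tau v)) = ∑' v, dv α v := by
    rw [tau.tsum_eq (fun v => dv α (tau v)), e1]
  have s1 : Summable (fun v => dv α (tau v)) := tau.summable_iff.2 hs
  have s2 : Summable (fun v => dv α (tau (tau v))) := tau.summable_iff.2 s1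
  have h : ∑' v, (dv α v + dv α (tau v) + dv α (tau (tau v))) = 0 := by
    rw [← tsum_zero (α := ℝ) (β := ℤ × ℤ)]
    congr 1; ext v
    unfold dv
    rw [N_tau, N_tau, N_tau, ← add_mul, ← add_mul]
    convert zero_mul _ using 2
    simp [tau]; ring
  rw [(hs.add s1).tsum_add s2, hs.tsum_add s1, e1, e2] at h
  linarith

theorem y_step {α y : ℝ} (hα : 1 ≤ α) (hy : √3 / 2 < y) :
    theta α (1 / 2) (√3 / 2) < theta α (1 / 2) y := by
  have hα0 : 0 < α := by linarith
  have hy0 : (0:ℝ) < √3 / 2 := by positivity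
  have hyp : 0 < y := hy0.trans hy
  set s := y⁻¹ with hs
  set s0 := (√3 / 2)⁻¹ with hs0
  have hsp : 0 < s := by positivity
  have hs0p : 0 < s0 := by positivity
  have hlt : s < s0 := inv_strictAnti₀ hy0 hy
  set c := π * α with hc
  have hcp : 0 < c := by positivity
  set E := ph c 0 1 s - ph c 0 1 s0 + c * ph c 0 1 s0 * (s - s0) with hE
  have hEp : 0 < E := by
    have e : ph c 0 1 s = ph c 0 1 s0 * exp (c * (s0 - s)) := by
      unfold ph; rw [← exp_add]; congr 1; ring
    have hp : 0 < ph c 0 1 s0 := exp_pos _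
    have hx : c * (s0 - s) ≠ 0 := mul_ne_zero hcp.ne' (sub_ne_zero.2 hlt.ne')
    have := add_one_lt_exp hx
    rw [hE, e]
    nlinarith
  have hs02 : ∀ a : ℝ, a / s0 ^ 2 = a * (3 / 4) := by
    intro a
    rw [hs0, inv_pow, div_pow, Real.sq_sqrt (by norm_num)]
    norm_num; ring
  set D : ℤ × ℤ → ℝ := fun v => pv α s v - pv α s0 v + c * (s - s0) * dv α v with hD
  have hterm : ∀ v, -(ww v * E) + (if v.1 = 0 ∧ (v.2 = 1 ∨ v.2 = -1) then E else 0) ≤ D v := by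
    intro v
    have hDv : D v = ph c ((v.1:ℝ) ^ 2) (((2 * v.2 + v.1 : ℤ) : ℝ) ^ 2 / 4) s
        - ph c ((v.1:ℝ) ^ 2) (((2 * v.2 + v.1 : ℤ) : ℝ) ^ 2 / 4) s0
        + c * ((((2 * v.2 + v.1 : ℤ) : ℝ) ^ 2 / 4) - (v.1:ℝ) ^ 2 / s0 ^ 2)
          * ph c ((v.1:ℝ) ^ 2) (((2 * v.2 + v.1 : ℤ) : ℝ) ^ 2 / 4) s0 * (s - s0) := by
      rw [hs02]
      have : dv α v = (((2 * v.2 + v.1 : ℤ) : ℝ) ^ 2 / 4 - (v.1:ℝ) ^ 2 * (3 / 4)) * pv α s0 v := by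
        rw [pv_eq]; rfl
      simp only [hD, this]
      unfold pv
      ring
    rw [hDv]
    split_ifs with h
    · obtain ⟨m, n⟩ := v
      simp only at h
      obtain ⟨rfl, h⟩ := h
      have hn : (n:ℝ) ^ 2 = 1 := by rcases h with rfl | rfl <;> norm_num
      have hw : ww (0, n) = 0 := by simp [ww, wW, wA, wB]
      have e1 : (((2 * n + 0 : ℤ) : ℝ) ^ 2 / 4) = 1 := by
        push_cast; linear_combination hn
      rw [hw]
      simp only [e1]
      apply le_of_eq
      rw [hE]; simp
    · rw [add_zero]
      apply ph_tangent hsp hlt.le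
      intro u hu hu2
      have hyu : √3 / 2 ≤ u⁻¹ := by
        rw [le_inv_comm₀ hy0 hu]; exact hu2
      have := cond_all hα hyu v
      simpa only [inv_pow, div_eq_mul_inv, inv_inv] using this
  have hsp1 : Summable (pv α s) := by
    refine (summable_theta (x := 1 / 2) hyp hα0).congr (fun v => ?_)
    rw [hs, pv_eq]
  have hsp2 : Summable (pv α s0) := by
    refine (summable_theta (x := 1 / 2) hy0 hα0).congr (fun v => ?_)
    rw [hs0, pv_eq]
  have t1 : ∑' v, pv α s v = theta α (1 / 2) y := tsum_congr (fun v => pv_eq α y v)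
  have t2 : ∑' v, pv α s0 v = theta α (1 / 2) (√3 / 2) := tsum_congr (fun v => pv_eq α _ v)
  have hsd := (summable_dv hα0).mul_left (c * (s - s0))
  have hDs : Summable D := (hsp1.sub hsp2).add hsd
  have tD : ∑' v, D v = theta α (1 / 2) y - theta α (1 / 2) (√3 / 2) := by
    rw [(hsp1.sub hsp2).tsum_add hsd, hsp1.tsum_sub hsp2, tsum_mul_left, tsum_dv hα0, t1, t2]
    ring
  have hspec : HasSum (fun v : ℤ × ℤ => if v.1 = 0 ∧ (v.2 = 1 ∨ v.2 = -1) then E else 0)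
      (2 * E) := by
    have h := hasSum_sum_of_ne_finset_zero (L := .unconditional _) (f := fun v : ℤ × ℤ =>
      if v.1 = 0 ∧ (v.2 = 1 ∨ v.2 = -1) then E else 0) (s := {((0:ℤ), (1:ℤ)), (0, -1)}) (by
        rintro ⟨a, b⟩ h
        simp at h ⊢
        intro ha hb
        subst ha
        rcases hb with rfl | rfl <;> simp at h)
    rw [Finset.sum_pair (by decide)] at h
    have e : 2 * E = E + E := by ring
    rw [e]
    simpa using h
  have hsw := (summable_ww.mul_right E).neg
  have hle := (hsw.add hspec.summable).tsum_le_tsum hterm hDs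
  rw [hsw.tsum_add hspec.summable, tsum_neg, tsum_mul_right, hspec.tsum_eq, tD] at hle
  have := tsum_ww
  nlinarith

end BM

namespace BM
open Real Set Filter Topology MeasureTheory

lemma montgomery_ge1 {α x y : ℝ} (hα : 1 ≤ α) (hy : √3 / 2 ≤ y) (hx1 : -(1 / 2) < x)
    (hx2 : x ≤ 1 / 2) (hne : ¬ (x = 1 / 2 ∧ y = √3 / 2)) :
    theta α (1 / 2) (√3 / 2) < theta α x y := by
  have hle : theta α (1 / 2) (√3 / 2) ≤ theta α (1 / 2) y := by
    rcases hy.eq_or_lt with rfl | h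
    · exact le_rfl
    · exact (y_step hα h).le
  rcases hx2.eq_or_lt with rfl | hx
  · exact y_step hα (lt_of_le_of_ne hy (fun h => hne ⟨rfl, h.symm⟩))
  · exact hle.trans_lt (x_step hα hy (abs_lt.2 ⟨hx1, hx⟩))

lemma montgomery {α x y : ℝ} (hα : 0 < α) (hy : √3 / 2 ≤ y) (hx1 : -(1 / 2) < x)
    (hx2 : x ≤ 1 / 2) (hne : ¬ (x = 1 / 2 ∧ y = √3 / 2)) :
    theta α (1 / 2) (√3 / 2) < theta α x y := by
  rcases le_or_gt 1 α with h | h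
  · exact montgomery_ge1 h hy hx1 hx2 hne
  · have h1 : 1 ≤ α⁻¹ := (one_le_inv₀ hα).2 h.le
    have h2 := montgomery_ge1 h1 hy hx1 hx2 hne
    have hy0 : (0:ℝ) < √3 / 2 := by positivity
    rw [theta_dual hα hy0, theta_dual hα (hy0.trans_le hy)] at h2
    exact lt_of_mul_lt_mul_left h2 hα.le

noncomputable def SS (t x y : ℝ) : ℝ := ∑' v : ℤ × ℤ, exp (-t * √(N x y v))

lemma sub_pos' (t r x : ℝ) : 0 < sub t r x := by unfold sub; positivity

lemma SS_pos {t x y : ℝ} (ht : 0 < t) (hy : 0 < y) : 0 < SS t x y :=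
  (summable_sqrtN hy ht).tsum_pos (fun _ => (exp_pos _).le) 0 (exp_pos _)

lemma SS_eq {t x y : ℝ} (ht : 0 < t) (hy : 0 < y) :
    IntegrableOn (fun z => ∑' v : ℤ × ℤ, sub t (√(N x y v)) z) (Ioi 0) ∧
    ∫ z in Ioi 0, ∑' v : ℤ × ℤ, sub t (√(N x y v)) z = √π / t * SS t x y := by
  have h1 : ∀ v : ℤ × ℤ, Integrable (sub t (√(N x y v))) (volume.restrict (Ioi 0)) :=
    fun v => (subord ht (Real.sqrt_nonneg _)).1
  have h2 : ∀ v : ℤ × ℤ, ∫ z in Ioi 0, sub t (√(N x y v)) z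
      = √π / t * exp (-t * √(N x y v)) := fun v => (subord ht (Real.sqrt_nonneg _)).2
  have h3 : ∀ v : ℤ × ℤ, ∫ z in Ioi 0, ‖sub t (√(N x y v)) z‖
      = √π / t * exp (-t * √(N x y v)) := fun v => by
    rw [← h2 v]; congr 1; ext z; rw [Real.norm_of_nonneg (sub_pos' _ _ _).le]
  have h4 := hasSum_integral_of_summable_integral_norm h1
    (((summable_sqrtN hy ht).mul_left (√π / t)).congr (fun v => (h3 v).symm))
  have h5 : ∫ z in Ioi 0, ∑' v : ℤ × ℤ, sub t (√(N x y v)) z = √π / t * SS t x y := by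
    rw [← h4.tsum_eq, SS, ← tsum_mul_left]
    exact tsum_congr h2
  refine ⟨?_, h5⟩
  apply Integrable.of_integral_ne_zero
  rw [h5]
  have := SS_pos (x := x) ht hy
  have hp := pi_pos
  positivity

lemma tsum_sub {t x y z : ℝ} (hy : 0 < y) (hz : 0 < z) :
    ∑' v : ℤ × ℤ, sub t (√(N x y v)) z
      = exp (-(t ^ 2 * z ^ 2 / 4)) * theta ((π * z ^ 2)⁻¹) x y := by
  unfold sub theta
  rw [tsum_mul_left]
  congr 1
  refine tsum_congr (fun v => ?_)
  rw [Real.sq_sqrt (N_nonneg hy v)]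
  congr 2
  have := pi_pos
  field_simp

theorem SS_lt {t x y : ℝ} (ht : 0 < t) (hy : √3 / 2 ≤ y) (hx1 : -(1 / 2) < x)
    (hx2 : x ≤ 1 / 2) (hne : ¬ (x = 1 / 2 ∧ y = √3 / 2)) :
    SS t (1 / 2) (√3 / 2) < SS t x y := by
  have hy0 : (0:ℝ) < √3 / 2 := by positivity
  have hyp := hy0.trans_le hy
  obtain ⟨i1, e1⟩ := SS_eq (x := 1 / 2) ht hy0
  obtain ⟨i2, e2⟩ := SS_eq (x := x) ht hyp
  have hpos : ∀ z : ℝ, 0 < z → 0 < (∑' v : ℤ × ℤ, sub t (√(N x y v)) z)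
      - ∑' v : ℤ × ℤ, sub t (√(N (1 / 2) (√3 / 2) v)) z := by
    intro z hz
    rw [tsum_sub hyp hz, tsum_sub hy0 hz, ← mul_sub]
    refine mul_pos (exp_pos _) (_root_.sub_pos.2 (montgomery ?_ hy hx1 hx2 hne))
    have := pi_pos
    positivity
  have h : 0 < ∫ z in Ioi 0, ((∑' v : ℤ × ℤ, sub t (√(N x y v)) z)
      - ∑' v : ℤ × ℤ, sub t (√(N (1 / 2) (√3 / 2) v)) z) := by
    refine (setIntegral_pos_iff_support_of_nonneg_ae ?_ (i2.sub i1)).2 ?_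
    · exact (ae_restrict_iff' measurableSet_Ioi).2 (Eventually.of_forall fun z hz => (hpos z hz).le)
    · have : (Ioi (0:ℝ)) ⊆ (Function.support fun z => ((∑' v : ℤ × ℤ, sub t (√(N x y v)) z)
          - ∑' v : ℤ × ℤ, sub t (√(N (1 / 2) (√3 / 2) v)) z)) ∩ Ioi 0 :=
        fun z hz => ⟨(hpos z hz).ne', hz⟩
      refine lt_of_lt_of_le ?_ (measure_mono this)
      simp
  rw [integral_sub i2 i1, e1, e2, ← mul_sub] at h
  have hp : 0 < √π / t := by have := pi_pos; positivity
  have := (mul_pos_iff_of_pos_left hp).1 h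
  linarith

end BM

namespace BM
open Real Set Filter Topology MeasureTheory

lemma reduction (p q r s : ℝ) (h : p * s - q * r = 1) :
    ∃ a b c d : ℤ, a * d - b * c = 1 ∧ ∃ x y : ℝ, √3 / 2 ≤ y ∧ -(1 / 2) < x ∧ x ≤ 1 / 2 ∧
      (c * p + d * q) ^ 2 + (c * r + d * s) ^ 2 = 1 / y ∧
      (a * p + b * q) * (c * p + d * q) + (a * r + b * s) * (c * r + d * s) = x / y := by
  -- it suffices to have the closed condition
  suffices H : ∃ a b c d : ℤ, a * d - b * c = 1 ∧ ∃ x y : ℝ, √3 / 2 ≤ y ∧ -(1 / 2) ≤ x ∧ x ≤ 1 / 2 ∧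
      (c * p + d * q) ^ 2 + (c * r + d * s) ^ 2 = 1 / y ∧
      (a * p + b * q) * (c * p + d * q) + (a * r + b * s) * (c * r + d * s) = x / y by
    obtain ⟨a, b, c, d, hdet, x, y, hy, hx1, hx2, e1, e2⟩ := H
    rcases hx1.eq_or_lt with rfl | hx
    · refine ⟨a + c, b + d, c, d, by linear_combination hdet, 1 / 2, y, hy, by norm_num, le_rfl,
        e1, ?_⟩
      push_cast
      have : (1 / 2 : ℝ) / y = -(1 / 2) / y + 1 / y := by ring
      rw [this]
      linear_combination e1 + e2
    · exact ⟨a, b, c, d, hdet, x, y, hy, hx, hx2, e1, e2⟩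
  set G := q ^ 2 + s ^ 2 with hG
  have hGp : 0 < G := by
    rcases eq_or_ne q 0 with rfl | hq
    · rcases eq_or_ne s 0 with rfl | hs
      · norm_num at h
      · positivity
    · positivity
  set F := p * q + r * s with hF
  have hlag : (p ^ 2 + r ^ 2) * G = F ^ 2 + 1 := by
    rw [hG, hF]; linear_combination (p * s - q * r + 1) * h
  let z : UpperHalfPlane := ⟨⟨F / G, 1 / G⟩, by show 0 < 1 / G; positivity⟩
  obtain ⟨g, hg⟩ := ModularGroup.exists_smul_mem_fd z
  obtain ⟨hg1, hg2⟩ := hg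
  set w : UpperHalfPlane := g • z with hw
  have hdet : g 0 0 * g 1 1 - g 0 1 * g 1 0 = 1 := by
    have := g.det_coe; rwa [Matrix.det_fin_two] at this
  have hwc := UpperHalfPlane.coe_specialLinearGroup_apply g z
  rw [← hw] at hwc
  set a := g 0 0
  set b := g 0 1
  set c := g 1 0
  set d := g 1 1
  have hdetR : (a:ℝ) * d - b * c = 1 := by exact_mod_cast hdet
  have hx := abs_le.1 hg2
  have hyp : 0 < w.im := w.im_pos
  have hQ : 0 < (c * p + d * q) ^ 2 + (c * r + d * s) ^ 2 := by
    rcases eq_or_ne ((c:ℝ) * p + d * q) 0 with h1 | h1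
    · rcases eq_or_ne ((c:ℝ) * r + d * s) 0 with h2 | h2
      · exfalso
        have hc : (c:ℝ) = 0 := by linear_combination s * h1 - q * h2 - c * h
        have hd : (d:ℝ) = 0 := by linear_combination p * h2 - r * h1 - d * h
        rw [hc, hd] at hdetR; norm_num at hdetR
      · positivity
    · positivity
  set Q := (c * p + d * q) ^ 2 + (c * r + d * s) ^ 2 with hQdef
  have hQe : Q * G = (c * F + d * G) ^ 2 + c ^ 2 := by
    rw [hQdef, hG, hF]
    linear_combination (c:ℝ) ^ 2 * (p * s - q * r + 1) * h
  have hwv : (w : ℂ) = (⟨((a * p + b * q) * (c * p + d * q) + (a * r + b * s) * (c * r + d * s)) / Q,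
      1 / Q⟩ : ℂ) := by
    rw [hwc]
    have hz : (z : ℂ) = (⟨F / G, 1 / G⟩ : ℂ) := rfl
    have hden : ((algebraMap ℤ ℝ c : ℂ) * z + (algebraMap ℤ ℝ d : ℂ)) ≠ 0 := by
      intro h0
      rw [hz] at h0
      have hr := congrArg Complex.re h0
      have hi := congrArg Complex.im h0
      simp at hr hi
      rcases hi with hi | hi
      · rw [hi] at hr
        simp at hr
        rw [hi, hr] at hdet; norm_num at hdet
      · exact hGp.ne' hi
    rw [div_eq_iff hden, hz]
    apply Complex.ext
    · simp
      field_simp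
      rw [hQdef, hG, hF]
      linear_combination (-(c:ℝ) * (p * s - q * r) ^ 2) * hdetR - c * (p * s - q * r + 1) * h
    · simp
      field_simp
      rw [hQdef, hG, hF]
      linear_combination ((c:ℝ) * (p * q + r * s) + d * (q ^ 2 + s ^ 2)) * hdetR
  have hre : w.re = ((a * p + b * q) * (c * p + d * q) + (a * r + b * s) * (c * r + d * s)) / Q :=
    congrArg Complex.re hwv
  have him : w.im = 1 / Q := congrArg Complex.im hwv
  refine ⟨a, b, c, d, hdet, w.re, w.im, ?_, by linarith [hx.1], hx.2, ?_, ?_⟩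
  · rw [Complex.normSq_apply] at hg1
    change 1 ≤ w.re * w.re + w.im * w.im at hg1
    have h3 : √3 ^ 2 = 3 := Real.sq_sqrt (by norm_num)
    have h4 : w.re ^ 2 ≤ (1 / 2) ^ 2 := sq_le_sq' (by linarith [hx.1]) hx.2
    apply le_of_sq_le_sq _ hyp.le
    nlinarith
  · rw [him, hQdef]; simp
  · rw [him, hre]; field_simp

end BM

namespace BM
open Real Set Filter Topology MeasureTheory

/-- The lattice vector with integer coordinates `v` in the basis `(P, R)`, `(Q, S)`. -/
noncomputable def lat (P Q R S : ℝ) (v : ℤ × ℤ) : EuclideanSpace ℝ (Fin 2) :=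
  !₂[v.1 * P + v.2 * Q, v.1 * R + v.2 * S]

lemma lat_inj {P Q R S : ℝ} (h : P * S - Q * R = 1) : Function.Injective (lat P Q R S) := by
  rintro ⟨a, b⟩ ⟨c, d⟩ e
  have e0 : (a:ℝ) * P + b * Q = c * P + d * Q := by
    simpa [lat] using congrArg (fun v : EuclideanSpace ℝ (Fin 2) => v 0) e
  have e1 : (a:ℝ) * R + b * S = c * R + d * S := by
    simpa [lat] using congrArg (fun v : EuclideanSpace ℝ (Fin 2) => v 1) e
  have h1 : (a:ℝ) = c := by linear_combination S * e0 - Q * e1 - (a - c) * h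
  have h2 : (b:ℝ) = d := by linear_combination P * e1 - R * e0 - (b - d) * h
  rw [Int.cast_inj] at h1 h2
  rw [h1, h2]

lemma lat_zero (P Q R S : ℝ) : lat P Q R S 0 = 0 := by
  ext i; fin_cases i <;> simp [lat]

lemma norm_lat {P Q R S x y : ℝ} (h : P * S - Q * R = 1) (hy : 0 < y)
    (h1 : Q ^ 2 + S ^ 2 = 1 / y) (h2 : P * Q + R * S = x / y) (v : ℤ × ℤ) :
    ‖lat P Q R S v‖ = √(N x y v) := by
  rw [EuclideanSpace.norm_eq]
  congr 1
  simp only [Fin.sum_univ_two, Real.norm_eq_abs, sq_abs]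
  have h3 : P ^ 2 + R ^ 2 = y + x ^ 2 / y := by
    have h4 : (P ^ 2 + R ^ 2) * (Q ^ 2 + S ^ 2) = (P * Q + R * S) ^ 2 + 1 := by
      linear_combination (P * S - Q * R + 1) * h
    rw [h1, h2] at h4
    field_simp at h4 ⊢
    linear_combination h4
  have e : N x y v = (v.1:ℝ) ^ 2 * (y + x ^ 2 / y) + 2 * v.1 * v.2 * (x / y)
      + (v.2:ℝ) ^ 2 * (1 / y) := by
    unfold N; field_simp; ring
  rw [e, ← h1, ← h2, ← h3]
  simp [lat]
  ring

lemma fLat_lat {P Q R S x y t : ℝ} (ht : 0 < t) (h : P * S - Q * R = 1) (hy : 0 < y)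
    (h1 : Q ^ 2 + S ^ 2 = 1 / y) (h2 : P * Q + R * S = x / y) :
    fLat t (range (lat P Q R S)) = SS t x y - 1 := by
  have hinj := lat_inj h
  have hset : range (lat P Q R S) \ {0} = lat P Q R S '' ((({0} : Finset (ℤ × ℤ)) : Set (ℤ × ℤ))ᶜ) := by
    rw [Set.image_compl_eq_range_sdiff_image hinj]
    simp [lat_zero]
  have hs := summable_sqrtN (x := x) hy ht
  unfold fLat
  rw [hset, tsum_image (fun p => exp (-t * ‖p‖)) hinj.injOn]
  simp only [norm_lat h hy h1 h2]
  have h5 := hs.sum_add_tsum_compl (s := {0})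
  simp only [Finset.sum_singleton] at h5
  have h6 : N x y 0 = 0 := by simp [N]
  rw [h6] at h5
  simp only [Real.sqrt_zero, mul_zero, exp_zero] at h5
  unfold SS
  linarith

lemma act_lat (A : Matrix (Fin 2) (Fin 2) ℝ) (P Q R S : ℝ) (v : ℤ × ℤ) :
    act A (lat P Q R S v) = lat (A 0 0 * P + A 0 1 * R) (A 0 0 * Q + A 0 1 * S)
      (A 1 0 * P + A 1 1 * R) (A 1 0 * Q + A 1 1 * S) v := by
  ext i
  fin_cases i <;> simp [act, lat, Matrix.mulVec, dotProduct, Fin.sum_univ_two] <;> ring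

lemma act_range (A : Matrix (Fin 2) (Fin 2) ℝ) (P Q R S : ℝ) :
    act A '' range (lat P Q R S) = range (lat (A 0 0 * P + A 0 1 * R) (A 0 0 * Q + A 0 1 * S)
      (A 1 0 * P + A 1 1 * R) (A 1 0 * Q + A 1 1 * S)) := by
  rw [← range_comp]
  congr 1
  funext v
  exact act_lat A P Q R S v

lemma intLat_eq : intLat = range (lat 1 0 0 1) := by
  ext v
  constructor
  · rintro ⟨a, b, h0, h1⟩
    refine ⟨(a, b), ?_⟩
    ext i; fin_cases i <;> simp [lat, h0, h1]
  · rintro ⟨⟨a, b⟩, rfl⟩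
    exact ⟨a, b, by simp [lat], by simp [lat]⟩

/-- side length of the triangular lattice -/
noncomputable def cc : ℝ := √(2 / √3)

lemma cc_pos : 0 < cc := by unfold cc; positivity
lemma cc_sq : cc ^ 2 = 2 / √3 := Real.sq_sqrt (by positivity)
lemma cc_mul : cc * (cc * √3 / 2) = 1 := by
  have h : cc * (cc * √3 / 2) = cc ^ 2 * √3 / 2 := by ring
  have h0 : √3 ≠ 0 := by positivity
  rw [h, cc_sq]; field_simp

lemma triLat_eq : triLat = range (lat cc (cc / 2) 0 (cc * √3 / 2)) := by
  ext v
  constructor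
  · rintro ⟨a, b, h0, h1⟩
    refine ⟨(a, b), ?_⟩
    ext i
    fin_cases i
    · simp [lat, h0, cc]; ring
    · simp [lat, h1, cc]; ring
  · rintro ⟨⟨a, b⟩, rfl⟩
    refine ⟨a, b, ?_, ?_⟩
    · simp [lat, cc]; ring
    · simp [lat, cc]; ring

lemma hex1 : (cc / 2) ^ 2 + (cc * √3 / 2) ^ 2 = 1 / (√3 / 2) := by
  have h3 : √3 ^ 2 = 3 := Real.sq_sqrt (by norm_num)
  have : 1 / (√3 / 2) = cc ^ 2 := by rw [cc_sq]; simp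
  rw [this]; linear_combination cc ^ 2 / 4 * h3

lemma hex2 : cc * (cc / 2) + 0 * (cc * √3 / 2) = (1 / 2) / (√3 / 2) := by
  have : (1 / 2) / (√3 / 2) = cc ^ 2 / 2 := by rw [cc_sq]; field_simp
  rw [this]; ring

lemma fLat_tri {t : ℝ} (ht : 0 < t) : fLat t triLat = SS t (1 / 2) (√3 / 2) - 1 := by
  rw [triLat_eq]
  exact fLat_lat ht (by linear_combination cc_mul) (by positivity) hex1 hex2

lemma fLat_rot {t : ℝ} (ht : 0 < t) {R : Matrix (Fin 2) (Fin 2) ℝ} (hR : IsRotation R) :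
    fLat t (act R '' triLat) = SS t (1 / 2) (√3 / 2) - 1 := by
  obtain ⟨hd, ho⟩ := hR
  have ho2 : R.transpose * R = 1 := mul_eq_one_comm.1 ho
  rw [Matrix.det_fin_two] at hd
  have o00 := congrFun (congrFun ho2 0) 0
  have o01 := congrFun (congrFun ho2 0) 1
  have o11 := congrFun (congrFun ho2 1) 1
  simp [Matrix.mul_apply, Fin.sum_univ_two] at o00 o01 o11
  rw [triLat_eq, act_range]
  refine fLat_lat ht ?_ (by positivity) ?_ ?_
  · linear_combination (cc * (cc * √3 / 2)) * hd + cc_mul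
  · rw [← hex1]
    linear_combination (cc / 2) ^ 2 * o00 + 2 * (cc / 2) * (cc * √3 / 2) * o01
      + (cc * √3 / 2) ^ 2 * o11
  · rw [← hex2]
    linear_combination cc * (cc / 2) * o00 + cc * (cc * √3 / 2) * o01

lemma range_change (p q r s : ℝ) (a b c d : ℤ) (h : a * d - b * c = 1) :
    range (lat p q r s)
      = range (lat (a * p + b * q) (c * p + d * q) (a * r + b * s) (c * r + d * s)) := by
  have hR : (a:ℝ) * d - b * c = 1 := by exact_mod_cast h
  ext v
  constructor
  · rintro ⟨⟨m, n⟩, rfl⟩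
    refine ⟨(d * m - c * n, a * n - b * m), ?_⟩
    ext i
    fin_cases i
    · simp [lat]; linear_combination (m * p + n * q) * hR
    · simp [lat]; linear_combination (m * r + n * s) * hR
  · rintro ⟨⟨m, n⟩, rfl⟩
    refine ⟨(m * a + n * c, m * b + n * d), ?_⟩
    ext i
    fin_cases i <;> simp [lat] <;> ring

theorem final (t : ℝ) (ht : 0 < t) (A : Matrix (Fin 2) (Fin 2) ℝ) (hA : A.det = 1) :
    fLat t triLat ≤ fLat t (act A '' intLat) ∧
    (fLat t (act A '' intLat) = fLat t triLat ↔
      ∃ R : Matrix (Fin 2) (Fin 2) ℝ, IsRotation R ∧ act A '' intLat = act R '' triLat) := by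
  rw [Matrix.det_fin_two] at hA
  obtain ⟨a, b, c, d, hdet, x, y, hy, hx1, hx2, e1, e2⟩ :=
    reduction (A 0 0) (A 0 1) (A 1 0) (A 1 1) hA
  have hdR : (a:ℝ) * d - b * c = 1 := by exact_mod_cast hdet
  have hy0 : (0:ℝ) < √3 / 2 := by positivity
  have hyp := hy0.trans_le hy
  have hL : act A '' intLat = range (lat (a * A 0 0 + b * A 0 1) (c * A 0 0 + d * A 0 1)
      (a * A 1 0 + b * A 1 1) (c * A 1 0 + d * A 1 1)) := by
    rw [intLat_eq, act_range, ← range_change _ _ _ _ a b c d hdet]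
    simp
  have hdet2 : (a * A 0 0 + b * A 0 1) * (c * A 1 0 + d * A 1 1)
      - (c * A 0 0 + d * A 0 1) * (a * A 1 0 + b * A 1 1) = 1 := by
    linear_combination (a * d - b * c) * hA + hdR
  generalize a * A 0 0 + b * A 0 1 = P at *
  generalize c * A 0 0 + d * A 0 1 = Q at *
  generalize a * A 1 0 + b * A 1 1 = R at *
  generalize c * A 1 0 + d * A 1 1 = S at *
  have hf := fLat_lat ht hdet2 hyp e1 e2
  rw [← hL] at hf
  by_cases hhex : x = 1 / 2 ∧ y = √3 / 2
  · obtain ⟨rfl, rfl⟩ := hhex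
    have heq : fLat t (act A '' intLat) = fLat t triLat := by rw [hf, fLat_tri ht]
    refine ⟨heq.ge, ⟨fun _ => ?_, fun _ => heq⟩⟩
    have hc := cc_pos
    have g1 : Q ^ 2 + S ^ 2 = cc ^ 2 := by rw [e1, cc_sq]; simp
    have g2 : P * Q + R * S = cc ^ 2 / 2 := by rw [e2, cc_sq]; field_simp
    have hk : cc * √3 / 2 = cc⁻¹ := by
      have := cc_mul
      exact eq_inv_of_mul_eq_one_right this
    have h5 : cc ^ 2 * cc ^ 2 * 3 = 4 := by
      have h3 : √3 ^ 2 = 3 := Real.sq_sqrt (by norm_num)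
      rw [cc_sq]; field_simp; rw [h3]; norm_num
    have g0 : P ^ 2 + R ^ 2 = cc ^ 2 := by
      have h4 : (P ^ 2 + R ^ 2) * (Q ^ 2 + S ^ 2) = (P * Q + R * S) ^ 2 + 1 := by
        linear_combination (P * S - Q * R + 1) * hdet2
      rw [g1, g2] at h4
      have h6 : cc ^ 2 ≠ 0 := by positivity
      apply mul_right_cancel₀ h6
      linear_combination h4 - h5 / 4
    refine ⟨!![P * cc⁻¹, Q * cc - P * cc / 2; R * cc⁻¹, S * cc - R * cc / 2], ⟨?_, ?_⟩, ?_⟩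
    · rw [Matrix.det_fin_two_of]
      have hi : cc * cc⁻¹ = 1 := mul_inv_cancel₀ hc.ne'
      linear_combination cc * cc⁻¹ * hdet2 + hi
    · rw [mul_eq_one_comm]
      ext i j
      fin_cases i <;> fin_cases j <;> simp [Matrix.mul_apply, Fin.sum_univ_two]
      · field_simp
        linear_combination g0
      · field_simp
        linear_combination 2 * g2 - g0
      · field_simp
        linear_combination 2 * g2 - g0
      · linear_combination cc ^ 2 * (g1 - g2 + g0 / 4) + h5 / 4
    · rw [hL, triLat_eq, act_range, hk]
      congr 2
      · simp; field_simp
      · simp; field_simp; ring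
      · simp; field_simp
      · simp; field_simp; ring
  · have hlt := SS_lt ht hy hx1 hx2 hhex
    rw [fLat_tri ht, hf]
    refine ⟨by linarith, ⟨fun h => by linarith, ?_⟩⟩
    rintro ⟨R', hR', he⟩
    rw [← hf, he, fLat_rot ht hR']

end BM

/-- Bétermin's theorem: among unimodular lattices `L = A(ℤ²)`, the sum
`∑_{p ∈ L \ {0}} exp (-t‖p‖)` is minimized exactly at the equilateral triangular
lattice, up to rotation. -/
theorem betermin
    (t : ℝ) (ht : 0 < t)
    (A : Matrix (Fin 2) (Fin 2) ℝ) (hA : A.det = 1) :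
    fLat t triLat ≤ fLat t (act A '' intLat) ∧
    (fLat t (act A '' intLat) = fLat t triLat ↔
      ∃ R : Matrix (Fin 2) (Fin 2) ℝ, IsRotation R ∧ act A '' intLat = act R '' triLat) := by
  exact BM.final t ht A hA
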